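/- Two triangulations T and T′ of the completed ∞-gon are strongly mutation equivalent if and only if either both are locally finite, or there exist a, b ∈ ℤ ∪ {−∞,+∞} such that both T and T′ have a left fountain at a and a right fountain at b, where either a ≤ b, or a = +∞ and b ∈ ℤ, or a ∈ ℤ and b = −∞. -/

import Mathlib

open scoped Classical

/-- Vertices of the completed ∞-gon: `ℤ ∪ {−∞, +∞}` with the extended linear order. -/
abbrev Vtx : Type := WithBot (WithTop ℤ)

/-- The vertex corresponding to an integer. -/
def vInt (m : ℤ) : Vtx := ((m : WithTop ℤ) : Vtx)

/-- The vertex `+∞`. -/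
def vTop : Vtx := ((⊤ : WithTop ℤ) : Vtx)

/-- The vertex `−∞`. -/
def vBot : Vtx := (⊥ : Vtx)

/-- An arc of the completed ∞-gon: a pair of vertices `src < tgt` such that if both
endpoints are integers then they differ by at least `2`. -/
structure Arc where
  src : Vtx
  tgt : Vtx
  lt : src < tgt
  sep : ∀ m n : ℤ, src = vInt m → tgt = vInt n → m + 2 ≤ n

/-- Two arcs `(a,b)` and `(c,d)` cross if `a < c < b < d` or `c < a < d < b`. -/
def Cross (x y : Arc) : Prop :=
  (x.src < y.src ∧ y.src < x.tgt ∧ x.tgt < y.tgt) ∨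
  (y.src < x.src ∧ x.src < y.tgt ∧ y.tgt < x.tgt)

/-- A triangulation of the completed ∞-gon: a maximal set of pairwise compatible
(= non-crossing) arcs. -/
def IsTriangulation (T : Set Arc) : Prop :=
  (∀ x ∈ T, ∀ y ∈ T, ¬ Cross x y) ∧
  ∀ γ : Arc, (∀ x ∈ T, ¬ Cross γ x) → γ ∈ T

lemma vInt_lt_vTop (m : ℤ) : vInt m < vTop := by
  simpa [vInt, vTop] using WithBot.coe_lt_coe.mpr (WithTop.coe_lt_top (m : ℤ))

lemma vBot_lt_vInt (m : ℤ) : vBot < vInt m := WithBot.bot_lt_coe _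

lemma vBot_lt_vTop : vBot < vTop := WithBot.bot_lt_coe _

lemma vTop_ne_vInt (n : ℤ) : vTop ≠ vInt n := by simp [vTop, vInt]

lemma vBot_ne_vInt (n : ℤ) : vBot ≠ vInt n := by simp [vBot, vInt]

/-- The Prüfer curve `π_m = (m, +∞)`. -/
def prufer (m : ℤ) : Arc :=
  ⟨vInt m, vTop, vInt_lt_vTop m, fun _ n _ h => absurd h (vTop_ne_vInt n)⟩

/-- The adic curve `α_m = (−∞, m)`. -/
def adic (m : ℤ) : Arc :=
  ⟨vBot, vInt m, vBot_lt_vInt m, fun k _ h _ => absurd h (vBot_ne_vInt k)⟩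

/-- The generic curve `z = (−∞, +∞)`. -/
def generic : Arc :=
  ⟨vBot, vTop, vBot_lt_vTop, fun k _ h _ => absurd h (vBot_ne_vInt k)⟩

/-- `T` contains an arc with endpoints `x` and `y`. -/
def HasArc (T : Set Arc) (x y : Vtx) : Prop := ∃ γ ∈ T, γ.src = x ∧ γ.tgt = y

/-- `T` has a right fountain at the integer `n`. -/
def RightFountainInt (T : Set Arc) (n : ℤ) : Prop :=
  {p : ℤ | HasArc T (vInt n) (vInt p)}.Infinite

/-- `T` has a left fountain at the integer `n`. -/
def LeftFountainInt (T : Set Arc) (n : ℤ) : Prop :=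
  {p : ℤ | HasArc T (vInt p) (vInt n)}.Infinite

/-- `T` has a right fountain at the vertex `v`. -/
def RightFountain (T : Set Arc) (v : Vtx) : Prop :=
  (∃ n : ℤ, v = vInt n ∧ RightFountainInt T n) ∨
  (v = vTop ∧ {p : ℤ | 0 ≤ p ∧ prufer p ∈ T}.Infinite) ∨
  (v = vBot ∧ {p : ℤ | 0 ≤ p ∧ adic p ∈ T}.Infinite)

/-- `T` has a left fountain at the vertex `v`. -/
def LeftFountain (T : Set Arc) (v : Vtx) : Prop :=
  (∃ n : ℤ, v = vInt n ∧ LeftFountainInt T n) ∨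
  (v = vTop ∧ {p : ℤ | p ≤ 0 ∧ prufer p ∈ T}.Infinite) ∨
  (v = vBot ∧ {p : ℤ | p ≤ 0 ∧ adic p ∈ T}.Infinite)

/-- `T` is locally finite if every vertex is an endpoint of only finitely many arcs of `T`. -/
def LocallyFin (T : Set Arc) : Prop :=
  ∀ v : Vtx, {γ | γ ∈ T ∧ (γ.src = v ∨ γ.tgt = v)}.Finite

/-- An arc is peripheral if both endpoints are integers. -/
def IsPeripheral (γ : Arc) : Prop :=
  (∃ m : ℤ, γ.src = vInt m) ∧ ∃ n : ℤ, γ.tgt = vInt n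

/-- `γ'` is an exchange partner for `γ` relative to `T`:
it is distinct from `γ` and `(T \ {γ}) ∪ {γ'}` is again a triangulation. -/
def MutExchange (T : Set Arc) (γ γ' : Arc) : Prop :=
  γ' ≠ γ ∧ IsTriangulation ((T \ {γ}) ∪ {γ'})

/-- `γ` is a mutable arc of `T`. -/
def IsMutable (T : Set Arc) (γ : Arc) : Prop :=
  γ ∈ T ∧ ∃ γ', MutExchange T γ γ'

/-- The (unique) replacement arc of `γ` in `T`, when `γ` is mutable. -/
noncomputable def flipArc (T : Set Arc) (γ : Arc) : Arc :=
  if h : ∃ γ', MutExchange T γ γ' then h.choose else γ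

/-- The mutation `μ_γ(T)` of `T` at `γ`. -/
noncomputable def mutate (T : Set Arc) (γ : Arc) : Set Arc :=
  (T \ {γ}) ∪ {flipArc T γ}

/-- `μ_γ(δ)`: the effect of the mutation of `T` at `γ` on the arc `δ`. -/
noncomputable def mutArc (T : Set Arc) (γ δ : Arc) : Arc :=
  if δ = γ then flipArc T γ else δ

/-- One step of a mutation sequence on a set of arcs (`none` = no entry). -/
noncomputable def stepT (T : Set Arc) : Option Arc → Set Arc
  | none => T
  | some γ => mutate T γ

/-- One step of a mutation sequence on a single arc. -/
noncomputable def stepA (T : Set Arc) : Option Arc → Arc → Arc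
  | none, δ => δ
  | some γ, δ => mutArc T γ δ

/-- `iterT T θ k` is `μ_{θ_k} ∘ ⋯ ∘ μ_{θ_1}(T)`. Sequences (finite or infinite) are
encoded as `θ : ℕ → Option Arc` whose support is downward closed. -/
noncomputable def iterT (T : Set Arc) (θ : ℕ → Option Arc) : ℕ → Set Arc
  | 0 => T
  | k + 1 => stepT (iterT T θ k) (θ k)

/-- `iterA T θ γ k` is `μ_{θ_k} ∘ ⋯ ∘ μ_{θ_1}(γ)`. -/
noncomputable def iterA (T : Set Arc) (θ : ℕ → Option Arc) (γ : Arc) : ℕ → Arc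
  | 0 => γ
  | k + 1 => stepA (iterT T θ k) (θ k) (iterA T θ γ k)

/-- `θ` is a `T`-admissible sequence: its support is downward closed (so it is a genuine
finite or infinite sequence), each entry is mutable in the triangulation obtained by the
previous mutations, and the mutation of each arc of `T` along `θ` eventually stabilizes. -/
def Admissible (T : Set Arc) (θ : ℕ → Option Arc) : Prop :=
  (∀ i, θ i = none → θ (i + 1) = none) ∧
  (∀ i γ, θ i = some γ → IsMutable (iterT T θ i) γ) ∧
  (∀ γ ∈ T, ∃ l, ∀ k, l ≤ k → iterA T θ γ k = iterA T θ γ l)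

/-- `μ_θ(γ)`: the stable value of the mutation of the arc `γ` along the sequence `θ`. -/
noncomputable def seqLimit (T : Set Arc) (θ : ℕ → Option Arc) (γ : Arc) : Arc :=
  if h : ∃ l, ∀ k, l ≤ k → iterA T θ γ k = iterA T θ γ l
  then iterA T θ γ h.choose else γ

/-- `μ_θ(T)`: the mutation of `T` along the sequence `θ`. -/
noncomputable def mutSeq (T : Set Arc) (θ : ℕ → Option Arc) : Set Arc :=
  seqLimit T θ '' T

/-- The sequence `θ` leaves the arc `γ` untouched. -/
def Untouched (T : Set Arc) (θ : ℕ → Option Arc) (γ : Arc) : Prop :=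
  ∀ l, iterA T θ γ l = γ

/-- The quadrilateral `S(γ)` of a mutable arc `γ` in `T`: with `v₁ < v₂ < v₃ < v₄` the four
endpoints of the two diagonals `γ` and `flipArc T γ`, it consists of those of the pairs
`(v₁,v₂), (v₂,v₃), (v₃,v₄), (v₁,v₄)` that are arcs. -/
noncomputable def quad (T : Set Arc) (γ : Arc) : Set Arc :=
  let γ' := flipArc T γ
  let vs : Vtx × Vtx × Vtx × Vtx :=
    if γ.src < γ'.src then (γ.src, γ'.src, γ.tgt, γ'.tgt) else (γ'.src, γ.src, γ'.tgt, γ.tgt)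
  {δ : Arc | (δ.src = vs.1 ∧ δ.tgt = vs.2.1) ∨ (δ.src = vs.2.1 ∧ δ.tgt = vs.2.2.1) ∨
    (δ.src = vs.2.2.1 ∧ δ.tgt = vs.2.2.2) ∨ (δ.src = vs.1 ∧ δ.tgt = vs.2.2.2)}

/-- The set `𝒫` of Prüfer curves compatible with every arc of `S`. -/
def pruferCompletion (S : Set Arc) : Set Arc :=
  {γ | (∃ k : ℤ, γ = prufer k) ∧ ∀ x ∈ S, ¬ Cross γ x}

/-- The set `𝒜̃` of adic curves compatible with every arc of `S ∪ 𝒫(S)`. -/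
def adicCompletion' (S : Set Arc) : Set Arc :=
  {γ | (∃ k : ℤ, γ = adic k) ∧ ∀ x ∈ S ∪ pruferCompletion S, ¬ Cross γ x}

/-- The completed (Prüfer) mutation `μ̄_θ(T) = μ_θ(T) ∪ 𝒫 ∪ 𝒜̃` of `T` along `θ`. -/
noncomputable def completedMut (T : Set Arc) (θ : ℕ → Option Arc) : Set Arc :=
  mutSeq T θ ∪ pruferCompletion (mutSeq T θ) ∪ adicCompletion' (mutSeq T θ)

/-- The tower of triangulations associated to a composition of completed mutations. -/
noncomputable def compIter (T : Set Arc) (Θ : ℕ → Option (ℕ → Option Arc)) : ℕ → Set Arc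
  | 0 => T
  | k + 1 =>
    match Θ k with
    | none => compIter T Θ k
    | some θ => completedMut (compIter T Θ k) θ

/-- `Θ` is a `T`-admissible composition of completed mutations. -/
def CompAdmissible (T : Set Arc) (Θ : ℕ → Option (ℕ → Option Arc)) : Prop :=
  (∀ i, Θ i = none → Θ (i + 1) = none) ∧
  ∀ i θ, Θ i = some θ → Admissible (compIter T Θ i) θ

/-- The transfinite mutation of `T` along the composition `Θ`. -/
noncomputable def transfiniteMut (T : Set Arc) (Θ : ℕ → Option (ℕ → Option Arc)) : Set Arc :=
  ⋃ i, {γ ∈ compIter T Θ i |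
    ∀ k, i ≤ k → ∀ θ, Θ k = some θ → Untouched (compIter T Θ k) θ γ}

/-- `T ≤_s T'`: there is a `T`-admissible sequence `θ` with `μ_θ(T) = T'`. -/
def leSc (T T' : Set Arc) : Prop :=
  ∃ θ : ℕ → Option Arc, Admissible T θ ∧ mutSeq T θ = T'


set_option linter.unusedVariables false

def Cr {α : Type*} [LinearOrder α] (a b c d : α) : Prop :=
  (a < c ∧ c < b ∧ b < d) ∨ (c < a ∧ a < d ∧ d < b)

lemma cross_iff (x y : Arc) : Cross x y ↔ Cr x.src x.tgt y.src y.tgt := Iff.rfl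

lemma cross_symm {x y : Arc} (h : Cross x y) : Cross y x := by
  unfold Cross at *; tauto

lemma not_cross_self (x : Arc) : ¬ Cross x x := by
  unfold Cross; simp

lemma arc_ext {x y : Arc} (h1 : x.src = y.src) (h2 : x.tgt = y.tgt) : x = y := by
  cases x; cases y; simp_all

/-- arc from a vertex strictly between -/
def mkArc (a u b : Vtx) (h1 : a < u) (h2 : u < b) : Arc :=
  ⟨a, b, h1.trans h2, by
    rintro m n rfl rfl
    induction u using WithBot.recBotCoe with
    | bot => simp at h1
    | coe u =>
      induction u using WithTop.recTopCoe with
      | top => simp [vInt] at h2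
      | coe u => simp [vInt] at h1 h2; omega⟩

section ord
variable {α : Type*} [LinearOrder α]

/-- sides of a quadrilateral -/
lemma ord_side1 {a b c d w1 w2 : α} (h1 : a < b) (h2 : b < c) (h3 : c < d) (hw : w1 < w2)
    (h : Cr a b w1 w2) (n1 : ¬ Cr w1 w2 a c) (n2 : ¬ Cr w1 w2 b d) : False := by
  unfold Cr at *; grind
lemma ord_side2 {a b c d w1 w2 : α} (h1 : a < b) (h2 : b < c) (h3 : c < d) (hw : w1 < w2)
    (h : Cr b c w1 w2) (n1 : ¬ Cr w1 w2 a c) (n2 : ¬ Cr w1 w2 b d) : False := by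
  unfold Cr at *; grind
lemma ord_side3 {a b c d w1 w2 : α} (h1 : a < b) (h2 : b < c) (h3 : c < d) (hw : w1 < w2)
    (h : Cr c d w1 w2) (n1 : ¬ Cr w1 w2 a c) (n2 : ¬ Cr w1 w2 b d) : False := by
  unfold Cr at *; grind
lemma ord_side4 {a b c d w1 w2 : α} (h1 : a < b) (h2 : b < c) (h3 : c < d) (hw : w1 < w2)
    (h : Cr a d w1 w2) (n1 : ¬ Cr w1 w2 a c) (n2 : ¬ Cr w1 w2 b d) : False := by
  unfold Cr at *; grind

lemma ord_quad1 {a b c d y1 y2 : α} (h1 : a < b) (h2 : b < c) (h3 : c < d) (hw : y1 < y2)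
    (h : Cr y1 y2 a c) : (y1 = b ∧ y2 = d) ∨ Cr y1 y2 a b ∨ Cr y1 y2 b c ∨ Cr y1 y2 c d
      ∨ Cr y1 y2 a d := by
  unfold Cr at *; grind
lemma ord_quad2 {a b c d y1 y2 : α} (h1 : a < b) (h2 : b < c) (h3 : c < d) (hw : y1 < y2)
    (h : Cr y1 y2 b d) : (y1 = a ∧ y2 = c) ∨ Cr y1 y2 a b ∨ Cr y1 y2 b c ∨ Cr y1 y2 c d
      ∨ Cr y1 y2 a d := by
  unfold Cr at *; grind

/-- key step -/
def KeyConc (s lo hi p1 q1 p2 q2 : α) : Prop :=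
  ∃ a b, (a = s ∨ b = s) ∧ (Cr p1 q1 a b ∧ ¬ Cr p2 q2 a b ∨ Cr p2 q2 a b ∧ ¬ Cr p1 q1 a b) ∧
        ∀ w1 w2, w1 < w2 → ¬ Cr w1 w2 p1 q1 → ¬ Cr w1 w2 p2 q2 → Cr w1 w2 a b → Cr w1 w2 lo hi

lemma ord_key_l {s t p1 q1 p2 q2 : α} (hst : s < t) (h1 : p1 < q1) (h2 : p2 < q2)
    (c1 : Cr p1 q1 s t) (c2 : Cr p2 q2 s t) (n : ¬ Cr p1 q1 p2 q2) (hne : ¬ (p1 = p2 ∧ q1 = q2)) :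
    KeyConc s s t p1 q1 p2 q2 := by
  have key : ∀ a b, (a = s ∨ b = s) →
      (Cr p1 q1 a b ∧ ¬ Cr p2 q2 a b ∨ Cr p2 q2 a b ∧ ¬ Cr p1 q1 a b) →
        (∀ w1 w2, w1 < w2 → ¬ Cr w1 w2 p1 q1 → ¬ Cr w1 w2 p2 q2 → Cr w1 w2 a b → Cr w1 w2 s t) →
        KeyConc s s t p1 q1 p2 q2 := fun a b h1 h2 h3 => ⟨a, b, h1, h2, h3⟩
  unfold Cr at *
  rcases c1 with c1 | c1 <;> rcases c2 with c2 | c2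
  · rcases lt_trichotomy q1 q2 with h | h | h
    · apply key s q2 <;> grind
    · rcases lt_trichotomy p1 p2 with h' | h' | h'
      · apply key p1 s <;> grind
      · grind
      · apply key p2 s <;> grind
    · apply key s q1 <;> grind
  · rcases lt_trichotomy q1 p2 with h | h | h
    · apply key s p2 <;> grind
    · apply key s q2 <;> grind
    · apply key s q1 <;> grind
  · rcases lt_trichotomy p1 q2 with h | h | h
    · apply key s q2 <;> grind
    · apply key s q1 <;> grind
    · apply key s p1 <;> grind
  · rcases lt_trichotomy p1 p2 with h | h | h
    · apply key s p2 <;> grind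
    · rcases lt_trichotomy q1 q2 with h' | h' | h'
      · apply key s q1 <;> grind
      · grind
      · apply key s q2 <;> grind
    · apply key s p1 <;> grind

lemma ord_key_r {s t p1 q1 p2 q2 : α} (hst : t < s) (h1 : p1 < q1) (h2 : p2 < q2)
    (c1 : Cr p1 q1 t s) (c2 : Cr p2 q2 t s) (n : ¬ Cr p1 q1 p2 q2) (hne : ¬ (p1 = p2 ∧ q1 = q2)) :
    KeyConc s t s p1 q1 p2 q2 := by
  have key : ∀ a b, (a = s ∨ b = s) →
      (Cr p1 q1 a b ∧ ¬ Cr p2 q2 a b ∨ Cr p2 q2 a b ∧ ¬ Cr p1 q1 a b) →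
        (∀ w1 w2, w1 < w2 → ¬ Cr w1 w2 p1 q1 → ¬ Cr w1 w2 p2 q2 → Cr w1 w2 a b → Cr w1 w2 t s) →
        KeyConc s t s p1 q1 p2 q2 := fun a b h1 h2 h3 => ⟨a, b, h1, h2, h3⟩
  unfold Cr at *
  rcases c1 with c1 | c1 <;> rcases c2 with c2 | c2
  · rcases lt_trichotomy q1 q2 with h | h | h
    · apply key q1 s <;> grind
    · rcases lt_trichotomy p1 p2 with h' | h' | h'
      · apply key p2 s <;> grind
      · grind
      · apply key p1 s <;> grind
    · apply key q2 s <;> grind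
  · rcases lt_trichotomy q1 p2 with h | h | h
    · apply key q1 s <;> grind
    · apply key p1 s <;> grind
    · apply key p2 s <;> grind
  · rcases lt_trichotomy p1 q2 with h | h | h
    · apply key p1 s <;> grind
    · apply key p2 s <;> grind
    · apply key q2 s <;> grind
  · rcases lt_trichotomy p1 p2 with h | h | h
    · apply key p1 s <;> grind
    · rcases lt_trichotomy q1 q2 with h' | h' | h'
      · apply key s q2 <;> grind
      · grind
      · apply key s q1 <;> grind
    · apply key p2 s <;> grind
end ord

lemma arc_of_cr {a b y1 y2 : Vtx} (h : Cr y1 y2 a b) : ∃ w : Arc, w.src = a ∧ w.tgt = b := by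
  rcases h with ⟨h1, h2, h3⟩ | ⟨h1, h2, h3⟩
  · exact ⟨mkArc a y2 b h2 h3, rfl, rfl⟩
  · exact ⟨mkArc a y1 b h1 h2, rfl, rfl⟩

lemma side_mem {X : Set Arc} (hX : IsTriangulation X) {a b y1 y2 : Vtx} (h : Cr y1 y2 a b)
    (hn : ∀ w ∈ X, ¬ Cr a b w.src w.tgt) : ∃ w ∈ X, w.src = a ∧ w.tgt = b := by
  obtain ⟨w, rfl, rfl⟩ := arc_of_cr h
  exact ⟨w, hX.2 w (fun x hx => hn x hx), rfl, rfl⟩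

def FlipOK (X : Set Arc) (x z : Arc) : Prop :=
  x ∈ X ∧ Cross z x ∧ ∀ w ∈ X, w ≠ x → ¬ Cross w z

lemma arcs_in_finite (V : Set Vtx) (hV : V.Finite) : {w : Arc | w.src ∈ V ∧ w.tgt ∈ V}.Finite := by
  apply Set.Finite.of_finite_image (f := fun w : Arc => (w.src, w.tgt))
  · apply (hV.prod hV).subset
    rintro _ ⟨w, hw, rfl⟩
    exact ⟨hw.1, hw.2⟩
  · intro x _ y _ h
    simp at h
    exact arc_ext h.1 h.2

lemma four {X : Set Arc} (hX : IsTriangulation X) {a b c d : Vtx} (h1 : a < b) (h2 : b < c)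
    (h3 : c < d) (H : ∀ w ∈ X, (w.src = a ∧ w.tgt = c) ∨ (w.src = b ∧ w.tgt = d) ∨
      (¬ Cr w.src w.tgt a c ∧ ¬ Cr w.src w.tgt b d)) :
    ∃ W : Set Arc, W.Finite ∧ W ⊆ X ∧
      (∀ w ∈ W, ¬ Cr w.src w.tgt a c ∧ ¬ Cr w.src w.tgt b d ∧ ¬ (w.src = a ∧ w.tgt = c) ∧
        ¬ (w.src = b ∧ w.tgt = d)) ∧
      (∀ y : Arc, Cr y.src y.tgt a c → (y.src = b ∧ y.tgt = d) ∨ ∃ w ∈ W, Cross y w) ∧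
      (∀ y : Arc, Cr y.src y.tgt b d → (y.src = a ∧ y.tgt = c) ∨ ∃ w ∈ W, Cross y w) := by
  let W : Set Arc := {w | w ∈ X ∧ ((w.src = a ∧ w.tgt = b) ∨ (w.src = b ∧ w.tgt = c) ∨
    (w.src = c ∧ w.tgt = d) ∨ (w.src = a ∧ w.tgt = d))}
  have s1 : ∀ y : Arc, Cr y.src y.tgt a b → ∃ w ∈ W, Cross y w := by
    intro y hy
    obtain ⟨w, hw, rfl, rfl⟩ := side_mem hX hy (by
      intro w hw hc
      rcases H w hw with h | h | h
      · unfold Cr at hc; grind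
      · unfold Cr at hc; grind
      · exact ord_side1 h1 h2 h3 w.lt hc h.1 h.2)
    exact ⟨w, ⟨hw, by simp⟩, hy⟩
  have s2 : ∀ y : Arc, Cr y.src y.tgt b c → ∃ w ∈ W, Cross y w := by
    intro y hy
    obtain ⟨w, hw, rfl, rfl⟩ := side_mem hX hy (by
      intro w hw hc
      rcases H w hw with h | h | h
      · unfold Cr at hc; grind
      · unfold Cr at hc; grind
      · exact ord_side2 h1 h2 h3 w.lt hc h.1 h.2)
    exact ⟨w, ⟨hw, by simp⟩, hy⟩
  have s3 : ∀ y : Arc, Cr y.src y.tgt c d → ∃ w ∈ W, Cross y w := by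
    intro y hy
    obtain ⟨w, hw, rfl, rfl⟩ := side_mem hX hy (by
      intro w hw hc
      rcases H w hw with h | h | h
      · unfold Cr at hc; grind
      · unfold Cr at hc; grind
      · exact ord_side3 h1 h2 h3 w.lt hc h.1 h.2)
    exact ⟨w, ⟨hw, by simp⟩, hy⟩
  have s4 : ∀ y : Arc, Cr y.src y.tgt a d → ∃ w ∈ W, Cross y w := by
    intro y hy
    obtain ⟨w, hw, rfl, rfl⟩ := side_mem hX hy (by
      intro w hw hc
      rcases H w hw with h | h | h
      · unfold Cr at hc; grind
      · unfold Cr at hc; grind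
      · exact ord_side4 h1 h2 h3 w.lt hc h.1 h.2)
    exact ⟨w, ⟨hw, by simp⟩, hy⟩
  refine ⟨W, ?_, fun w hw => hw.1, ?_, ?_, ?_⟩
  · apply (arcs_in_finite {a, b, c, d} (by simp)).subset
    rintro w ⟨-, hw⟩
    simp only [Set.mem_ofPred_eq, Set.mem_insert_iff, Set.mem_singleton_iff]
    tauto
  · rintro w ⟨-, hw⟩
    unfold Cr
    rcases hw with ⟨e1, e2⟩ | ⟨e1, e2⟩ | ⟨e1, e2⟩ | ⟨e1, e2⟩ <;> rw [e1, e2] <;> grind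
  · intro y hy
    rcases ord_quad1 h1 h2 h3 y.lt hy with h | h | h | h | h
    · exact Or.inl h
    · exact Or.inr (s1 y h)
    · exact Or.inr (s2 y h)
    · exact Or.inr (s3 y h)
    · exact Or.inr (s4 y h)
  · intro y hy
    rcases ord_quad2 h1 h2 h3 y.lt hy with h | h | h | h | h
    · exact Or.inl h
    · exact Or.inr (s1 y h)
    · exact Or.inr (s2 y h)
    · exact Or.inr (s3 y h)
    · exact Or.inr (s4 y h)

lemma quad_lemma {X : Set Arc} (hX : IsTriangulation X) {x z : Arc} (h : FlipOK X x z) :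
    ∃ W : Set Arc, W.Finite ∧ W ⊆ X ∧ x ∉ W ∧
      (∀ y : Arc, Cross y x → y = z ∨ ∃ w ∈ W, Cross y w) ∧
      (∀ y : Arc, Cross y z → y = x ∨ ∃ w ∈ W, Cross y w) := by
  obtain ⟨hx, hzx, hz⟩ := h
  have hn : ∀ w ∈ X, ¬ Cross w x := fun w hw => hX.1 w hw x hx
  rcases hzx with ⟨h1, h2, h3⟩ | ⟨h1, h2, h3⟩
  · obtain ⟨W, f1, f2, f3, f4, f5⟩ := four hX h1 h2 h3 (by
      intro w hw
      by_cases hwx : w = x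
      · subst hwx; simp
      · exact Or.inr (Or.inr ⟨hz w hw hwx, hn w hw⟩))
    refine ⟨W, f1, f2, fun hxW => (f3 x hxW).2.2.2 ⟨rfl, rfl⟩, ?_, ?_⟩
    · intro y hy
      exact (f5 y hy).imp (fun h => arc_ext h.1 h.2) id
    · intro y hy
      exact (f4 y hy).imp (fun h => arc_ext h.1 h.2) id
  · obtain ⟨W, f1, f2, f3, f4, f5⟩ := four hX h1 h2 h3 (by
      intro w hw
      by_cases hwx : w = x
      · subst hwx; simp
      · exact Or.inr (Or.inr ⟨hn w hw, hz w hw hwx⟩))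
    refine ⟨W, f1, f2, fun hxW => (f3 x hxW).2.2.1 ⟨rfl, rfl⟩, ?_, ?_⟩
    · intro y hy
      exact (f4 y hy).imp (fun h => arc_ext h.1 h.2) id
    · intro y hy
      exact (f5 y hy).imp (fun h => arc_ext h.1 h.2) id

lemma FlipOK.tri {X : Set Arc} (hX : IsTriangulation X) {x z : Arc} (h : FlipOK X x z) :
    IsTriangulation ((X \ {x}) ∪ {z}) := by
  obtain ⟨W, f1, f2, f3, f4, f5⟩ := quad_lemma hX h
  obtain ⟨hx, hzx, hz⟩ := h
  constructor
  · rintro u (⟨hu, hux⟩ | rfl) v (⟨hv, hvx⟩ | rfl)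
    · exact hX.1 u hu v hv
    · exact hz u hu hux
    · exact fun hc => hz v hv hvx (cross_symm hc)
    · exact not_cross_self _
  · intro γ hγ
    by_cases hc : Cross γ x
    · rcases f4 γ hc with rfl | ⟨w, hw, hcw⟩
      · exact Or.inr rfl
      · exact absurd hcw (hγ w (Or.inl ⟨f2 hw, fun e => f3 (e ▸ hw)⟩))
    · have hm : γ ∈ X := hX.2 γ (by
        intro w hw
        by_cases e : w = x
        · rwa [e]
        · exact hγ w (Or.inl ⟨hw, e⟩))
      by_cases e : γ = x
      · subst e
        exact absurd (cross_symm hzx) (hγ z (Or.inr rfl))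
      · exact Or.inl ⟨hm, e⟩

lemma flipOK_of_exchange {X : Set Arc} (hX : IsTriangulation X) {x z : Arc} (hx : x ∈ X)
    (h : MutExchange X x z) : FlipOK X x z := by
  obtain ⟨hne, ht⟩ := h
  have hz : ∀ w ∈ X, w ≠ x → ¬ Cross w z := fun w hw e =>
    ht.1 w (Or.inl ⟨hw, e⟩) z (Or.inr rfl)
  refine ⟨hx, ?_, hz⟩
  by_contra hc
  have : x ∈ (X \ {x}) ∪ {z} := ht.2 x (by
    rintro w (⟨hw, -⟩ | rfl)
    · exact hX.1 x hx w hw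
    · exact fun h => hc (cross_symm h))
  rcases this with ⟨-, h⟩ | h
  · exact h rfl
  · exact hne h.symm

lemma FlipOK.exchange {X : Set Arc} (hX : IsTriangulation X) {x z : Arc} (h : FlipOK X x z) :
    MutExchange X x z :=
  ⟨fun e => not_cross_self x (e ▸ h.2.1), h.tri hX⟩

lemma FlipOK.unique {X : Set Arc} (hX : IsTriangulation X) {x z z' : Arc} (h : FlipOK X x z)
    (h' : FlipOK X x z') : z' = z := by
  obtain ⟨W, f1, f2, f3, f4, f5⟩ := quad_lemma hX h
  rcases f4 z' h'.2.1 with h1 | ⟨w, hw, hc⟩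
  · exact h1
  · exact absurd (cross_symm hc) (h'.2.2 w (f2 hw) (fun e => f3 (e ▸ hw)))

lemma FlipOK.mutable {X : Set Arc} (hX : IsTriangulation X) {x z : Arc} (h : FlipOK X x z) :
    IsMutable X x := ⟨h.1, z, h.exchange hX⟩

lemma mutable_flipOK {X : Set Arc} (hX : IsTriangulation X) {x : Arc} (h : IsMutable X x) :
    FlipOK X x (flipArc X x) := by
  obtain ⟨hx, hex⟩ := h
  apply flipOK_of_exchange hX hx
  unfold flipArc
  rw [dif_pos hex]
  exact hex.choose_spec

lemma FlipOK.flipArc_eq {X : Set Arc} (hX : IsTriangulation X) {x z : Arc} (h : FlipOK X x z) :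
    flipArc X x = z :=
  h.unique hX (mutable_flipOK hX (h.mutable hX))

lemma mutate_tri {X : Set Arc} (hX : IsTriangulation X) {x : Arc} (h : IsMutable X x) :
    IsTriangulation (mutate X x) := (mutable_flipOK hX h).tri hX

/-- key lemma: first flip towards `y`. -/
lemma key_flip {X : Set Arc} (hX : IsTriangulation X) (s : Vtx) : ∀ (n : ℕ) (y : Arc),
    (y.src = s ∨ y.tgt = s) → {x | x ∈ X ∧ Cross x y}.Finite →
    {x | x ∈ X ∧ Cross x y}.ncard = n → {x | x ∈ X ∧ Cross x y}.Nonempty →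
    ∃ x z, FlipOK X x z ∧ Cross x y ∧ (z.src = s ∨ z.tgt = s) := by
  intro n
  induction n using Nat.strong_induction_on with
  | _ n ih =>
    intro y hy hfin hn ⟨x1, hx1, hc1⟩
    by_cases hu : ∀ w ∈ X, w ≠ x1 → ¬ Cross w y
    · exact ⟨x1, y, ⟨hx1, cross_symm hc1, hu⟩, hc1, hy⟩
    push Not at hu
    obtain ⟨x2, hx2, hne, hc2⟩ := hu
    have hk : KeyConc s y.src y.tgt x1.src x1.tgt x2.src x2.tgt := by
      rcases hy with rfl | rfl
      · exact ord_key_l y.lt x1.lt x2.lt hc1 hc2 (hX.1 x1 hx1 x2 hx2)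
          (fun e => hne (arc_ext e.1 e.2).symm)
      · exact ord_key_r y.lt x1.lt x2.lt hc1 hc2 (hX.1 x1 hx1 x2 hx2)
          (fun e => hne (arc_ext e.1 e.2).symm)
    obtain ⟨a, b, hab, hex, hall⟩ := hk
    have : ∃ z : Arc, z.src = a ∧ z.tgt = b := by
      rcases hex with h | h
      · exact arc_of_cr h.1
      · exact arc_of_cr h.1
    obtain ⟨z, rfl, rfl⟩ := this
    have hsub : {x | x ∈ X ∧ Cross x z} ⊆ {x | x ∈ X ∧ Cross x y} := by
      rintro w ⟨hw, hc⟩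
      exact ⟨hw, hall _ _ w.lt (hX.1 w hw x1 hx1) (hX.1 w hw x2 hx2) hc⟩
    have hss : {x | x ∈ X ∧ Cross x z} ⊂ {x | x ∈ X ∧ Cross x y} := by
      refine ⟨hsub, fun hs => ?_⟩
      rcases hex with h | h
      · exact h.2 (hs ⟨hx2, hc2⟩).2
      · exact h.2 (hs ⟨hx1, hc1⟩).2
    have hlt := Set.ncard_lt_ncard hss hfin
    obtain ⟨x, z', h1, h2, h3⟩ := ih _ (hn ▸ hlt) z hab (hfin.subset hsub) rfl (by
      rcases hex with h | h
      · exact ⟨x1, hx1, h.1⟩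
      · exact ⟨x2, hx2, h.1⟩)
    exact ⟨x, z', h1, (hsub ⟨h1.1, h2⟩).2, h3⟩

lemma not_cross_of_src {z y : Arc} (h : z.src = y.src ∨ z.tgt = y.src) : ¬ Cross z y := by
  have := z.lt; have := y.lt
  unfold Cross; grind

lemma key_flip' {X : Set Arc} (hX : IsTriangulation X) (y : Arc)
    (hf : {x | x ∈ X ∧ Cross x y}.Finite) (hy : y ∉ X) :
    ∃ x z, FlipOK X x z ∧ Cross x y ∧ ¬ Cross z y := by
  obtain ⟨x, z, h1, h2, h3⟩ := key_flip hX y.src _ y (Or.inl rfl) hf rfl (by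
    by_contra hne
    apply hy
    apply hX.2
    intro x hx hc
    exact hne ⟨x, hx, cross_symm hc⟩)
  exact ⟨x, z, h1, h2, not_cross_of_src h3⟩

section ord
variable {α : Type*} [LinearOrder α]

lemma ord_sepA {e1 e2 g1 g2 y1 y2 v : α} (he : e1 < e2) (hg : g1 < g2) (hy : y1 < y2)
    (h : Cr e1 e2 g1 g2) (ne : ¬ Cr e1 e2 y1 y2) (ng : ¬ Cr g1 g2 y1 y2) (hv : v = e1 ∨ v = e2)
    (h1 : y1 < v) (h2 : v < y2) : y1 ≤ g1 ∧ g2 ≤ y2 := by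
  unfold Cr at *; grind
lemma ord_sepB {e1 e2 g1 g2 y1 y2 v : α} (he : e1 < e2) (hg : g1 < g2) (hy : y1 < y2)
    (h : Cr e1 e2 g1 g2) (ne : ¬ Cr e1 e2 y1 y2) (ng : ¬ Cr g1 g2 y1 y2) (hv : v = e1 ∨ v = e2)
    (h1 : v < y1 ∨ y2 < v) : (g1 ≤ y1 ∨ y2 ≤ g1) ∧ (g2 ≤ y1 ∨ y2 ≤ g2) := by
  unfold Cr at *; grind
lemma ord_sepA' {g1 g2 y1 y2 v : α} (hg : g1 < g2) (hy : y1 < y2)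
    (ng : ¬ Cr g1 g2 y1 y2) (hv : v = g1 ∨ v = g2)
    (h1 : y1 < v) (h2 : v < y2) : y1 ≤ g1 ∧ g2 ≤ y2 := by
  unfold Cr at *; grind
lemma ord_sepB' {g1 g2 y1 y2 v : α} (hg : g1 < g2) (hy : y1 < y2)
    (ng : ¬ Cr g1 g2 y1 y2) (hv : v = g1 ∨ v = g2)
    (h1 : v < y1 ∨ y2 < v) : (g1 ≤ y1 ∨ y2 ≤ g1) ∧ (g2 ≤ y1 ∨ y2 ≤ g2) := by
  unfold Cr at *; grind

lemma ord_gap {V : Set α} (hV : V.Finite) {z1 z2 h1 h2 : α} (hz : z1 < z2) (hh : h1 < h2)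
    (hh1 : h1 ∈ V) (hh2 : h2 ∈ V) (hc : Cr z1 z2 h1 h2) (hn : ¬ (z1 ∈ V ∧ z2 ∈ V)) :
    ∃ a ∈ V, ∃ b ∈ V, a < b ∧ Cr z1 z2 a b ∧ ((∀ v ∈ V, v ≤ a ∨ b ≤ v) ∨ (∀ v ∈ V, a ≤ v ∧ v ≤ b)) := by
  have : ∃ u, u ∉ V ∧ (u = z1 ∨ u = z2) := by
    by_cases h : z1 ∈ V
    · exact ⟨z2, fun h' => hn ⟨h, h'⟩, Or.inr rfl⟩
    · exact ⟨z1, h, Or.inl rfl⟩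
  obtain ⟨u, hu, huz⟩ := this
  have hu' : ∀ v ∈ V, v ≠ u := fun v hv e => hu (e ▸ hv)
  by_cases hi : (∃ v ∈ V, v < u) ∧ (∃ v ∈ V, u < v)
  · obtain ⟨⟨v, hv, hvu⟩, ⟨v', hv', hvu'⟩⟩ := hi
    obtain ⟨a, ⟨ha, hau⟩, hamax⟩ := Set.exists_max_image (V ∩ {v | v < u}) id
      (hV.inter_of_left _) ⟨v, hv, hvu⟩
    obtain ⟨b, ⟨hb, hbu⟩, hbmin⟩ := Set.exists_min_image (V ∩ {v | u < v}) id
      (hV.inter_of_left _) ⟨v', hv', hvu'⟩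
    simp only [Set.mem_ofPred_eq, Set.mem_inter_iff, id] at *
    have hgap : ∀ v ∈ V, v ≤ a ∨ b ≤ v := by
      intro v hv
      rcases lt_or_gt_of_ne (hu' v hv) with h | h
      · exact Or.inl (hamax v ⟨hv, h⟩)
      · exact Or.inr (hbmin v ⟨hv, h⟩)
    refine ⟨a, ha, b, hb, hau.trans hbu, ?_, Or.inl hgap⟩
    have := hgap h1 hh1
    have := hgap h2 hh2
    clear hamax hbmin hgap hu'
    unfold Cr at *; grind
  · obtain ⟨a, ha, hamin⟩ := Set.exists_min_image V id hV ⟨_, hh1⟩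
    obtain ⟨b, hb, hbmax⟩ := Set.exists_max_image V id hV ⟨_, hh1⟩
    simp only [id] at *
    refine ⟨a, ha, b, hb, ?_, ?_, Or.inr fun v hv => ⟨hamin v hv, hbmax v hv⟩⟩
    · exact lt_of_le_of_lt (hamin _ hh1) (lt_of_lt_of_le hh (hbmax _ hh2))
    · have h3 := hamin _ hh1
      have h4 := hbmax _ hh2
      have h5 : u < a ∨ b < u := by
        by_contra hcon
        push Not at hcon
        exact hi ⟨⟨a, ha, lt_of_le_of_ne hcon.1 (hu' a ha)⟩,
          ⟨b, hb, lt_of_le_of_ne hcon.2 (hu' b hb).symm⟩⟩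
      clear hamin hbmax hi
      unfold Cr at *; grind
end ord

/-- vertices of the cell of `g` -/
def cellV (T : Set Arc) (g : Arc) : Set Vtx :=
  {v | ∃ e : Arc, (e = g ∨ (e ∈ T ∧ Cross e g)) ∧ (v = e.src ∨ v = e.tgt)}

lemma cellV_finite {T : Set Arc} {g : Arc} (hf : {y | y ∈ T ∧ Cross y g}.Finite) :
    (cellV T g).Finite := by
  have h1 : ({g} ∪ {y | y ∈ T ∧ Cross y g} : Set Arc).Finite := (Set.finite_singleton g).union hf
  apply ((h1.image Arc.src).union (h1.image Arc.tgt)).subset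
  rintro v ⟨e, he, hv⟩
  have he' : e ∈ ({g} ∪ {y | y ∈ T ∧ Cross y g} : Set Arc) := he
  rcases hv with rfl | rfl
  · exact Or.inl ⟨e, he', rfl⟩
  · exact Or.inr ⟨e, he', rfl⟩

lemma cell_side {T : Set Arc} (hT : IsTriangulation T) {g y : Arc} {a b : Vtx}
    (ha : a ∈ cellV T g) (hb : b ∈ cellV T g) (hy : y ∈ T)
    (hyV : ¬ (y.src ∈ cellV T g ∧ y.tgt ∈ cellV T g))
    (h1 : y.src < a) (h2 : a < y.tgt) (h3 : b < y.src ∨ y.tgt < b) : False := by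
  have hgy : ¬ Cross g y := by
    intro hc
    exact hyV ⟨⟨y, Or.inr ⟨hy, cross_symm hc⟩, Or.inl rfl⟩, ⟨y, Or.inr ⟨hy, cross_symm hc⟩, Or.inr rfl⟩⟩
  have hA : y.src ≤ g.src ∧ g.tgt ≤ y.tgt := by
    obtain ⟨e, he, hv⟩ := ha
    rcases he with rfl | ⟨heT, hec⟩
    · exact ord_sepA' e.lt y.lt hgy hv h1 h2
    · exact ord_sepA e.lt g.lt y.lt hec (hT.1 e heT y hy) hgy hv h1 h2
  have hB : (g.src ≤ y.src ∨ y.tgt ≤ g.src) ∧ (g.tgt ≤ y.src ∨ y.tgt ≤ g.tgt) := by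
    obtain ⟨e, he, hv⟩ := hb
    rcases he with rfl | ⟨heT, hec⟩
    · exact ord_sepB' e.lt y.lt hgy hv h3
    · exact ord_sepB e.lt g.lt y.lt hec (hT.1 e heT y hy) hgy hv h3
  have hg := g.lt
  have hy' := y.lt
  apply hyV
  have e1 : y.src = g.src := by grind
  have e2 : y.tgt = g.tgt := by grind
  exact ⟨⟨g, Or.inl rfl, Or.inl e1⟩, ⟨g, Or.inl rfl, Or.inr e2⟩⟩

lemma cell_sep {T : Set Arc} (hT : IsTriangulation T) {g : Arc}
    (hf : {y | y ∈ T ∧ Cross y g}.Finite) {z h : Arc} (hc : Cross z h)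
    (hh : h.src ∈ cellV T g ∧ h.tgt ∈ cellV T g)
    (hz : ¬ (z.src ∈ cellV T g ∧ z.tgt ∈ cellV T g)) :
    ∃ b ∈ T, (b.src ∈ cellV T g ∧ b.tgt ∈ cellV T g) ∧ ¬ Cross b g ∧ Cross z b := by
  obtain ⟨a, ha, b, hb, hab, hzab, hgap⟩ :=
    ord_gap (cellV_finite hf) z.lt h.lt hh.1 hh.2 hc hz
  have key : ∀ v1 ∈ cellV T g, ∀ v2 ∈ cellV T g, v1 < v2 → ¬ Cr a b v1 v2 := by
    intro v1 hv1 v2 hv2 hlt hcr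
    rcases hgap with hgap | hgap
    · have := hgap v1 hv1
      have := hgap v2 hv2
      unfold Cr at hcr; grind
    · have := hgap v1 hv1
      have := hgap v2 hv2
      unfold Cr at hcr; grind
  obtain ⟨w, hw, rfl, rfl⟩ := side_mem hT hzab (by
    intro y hy hcr
    have hyV : ¬ (y.src ∈ cellV T g ∧ y.tgt ∈ cellV T g) := fun hyV =>
      key _ hyV.1 _ hyV.2 y.lt hcr
    rcases hcr with ⟨c1, c2, c3⟩ | ⟨c1, c2, c3⟩
    · exact cell_side hT hb ha hy hyV c2 c3 (Or.inl c1)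
    · exact cell_side hT ha hb hy hyV c1 c2 (Or.inr c3))
  refine ⟨w, hw, ⟨ha, hb⟩, ?_, hzab⟩
  exact key _ ⟨g, Or.inl rfl, Or.inl rfl⟩ _ ⟨g, Or.inl rfl, Or.inr rfl⟩ g.lt

/-! finite runs -/

noncomputable def runT : Set Arc → List Arc → Set Arc
  | X, [] => X
  | X, x :: l => runT (mutate X x) l

noncomputable def runA : Set Arc → List Arc → Arc → Arc
  | _, [], g => g
  | X, x :: l, g => runA (mutate X x) l (mutArc X x g)

def Valid (S : Set Arc) : Set Arc → List Arc → Prop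
  | _, [] => True
  | X, x :: l => IsMutable X x ∧ x ∈ S ∧ Valid S (mutate X x) l

lemma runT_append (X : Set Arc) (l l' : List Arc) : runT X (l ++ l') = runT (runT X l) l' := by
  induction l generalizing X with
  | nil => rfl
  | cons x l ih => exact ih _

lemma runA_append (X : Set Arc) (l l' : List Arc) (g : Arc) :
    runA X (l ++ l') g = runA (runT X l) l' (runA X l g) := by
  induction l generalizing X g with
  | nil => rfl
  | cons x l ih => exact ih _ _

lemma valid_append {S : Set Arc} {X : Set Arc} {l l' : List Arc} :
    Valid S X (l ++ l') ↔ Valid S X l ∧ Valid S (runT X l) l' := by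
  induction l generalizing X with
  | nil => simp [Valid, runT]
  | cons x l ih => simp [Valid, runT, ih, and_assoc]

lemma Valid.mono {S S' : Set Arc} (h : S ⊆ S') {X : Set Arc} {l : List Arc} (hv : Valid S X l) :
    Valid S' X l := by
  induction l generalizing X with
  | nil => trivial
  | cons x l ih => exact ⟨hv.1, h hv.2.1, ih hv.2.2⟩

lemma keep {S X : Set Arc} {l : List Arc} (hv : Valid S X l) {g : Arc} (hg : g ∉ S) :
    runA X l g = g ∧ (g ∈ X → g ∈ runT X l) := by
  induction l generalizing X with
  | nil => exact ⟨rfl, id⟩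
  | cons x l ih =>
    have hne : g ≠ x := fun e => hg (e ▸ hv.2.1)
    have := ih hv.2.2
    refine ⟨?_, fun hX => this.2 (Or.inl ⟨hX, hne⟩)⟩
    simp only [runA, mutArc, if_neg hne]
    exact this.1

lemma mutArc_mem {X : Set Arc} {x g : Arc} (hg : g ∈ X) : mutArc X x g ∈ mutate X x := by
  unfold mutArc mutate
  split_ifs with h
  · exact Or.inr rfl
  · exact Or.inl ⟨hg, h⟩

lemma runA_mem {X : Set Arc} {l : List Arc} {g : Arc} (hg : g ∈ X) : runA X l g ∈ runT X l := by
  induction l generalizing X g with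
  | nil => exact hg
  | cons x l ih => exact ih (mutArc_mem hg)

structure FInv (T' X : Set Arc) : Prop where
  tri : IsTriangulation X
  fin1 : ∀ y ∈ T', {x | x ∈ X ∧ Cross x y}.Finite
  fin2 : ∀ x ∈ X, {y | y ∈ T' ∧ Cross y x}.Finite

lemma FInv.mutate {T' X : Set Arc} (h : FInv T' X) {x : Arc} (hx : IsMutable X x) :
    FInv T' (mutate X x) := by
  have hf := mutable_flipOK h.tri hx
  refine ⟨mutate_tri h.tri hx, ?_, ?_⟩
  · intro y hy
    apply ((h.fin1 y hy).union (Set.finite_singleton (flipArc X x))).subset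
    rintro w ⟨hw | hw, hc⟩
    · exact Or.inl ⟨hw.1, hc⟩
    · exact Or.inr hw
  · rintro w (hw | hw)
    · exact h.fin2 w hw.1
    · rw [Set.mem_singleton_iff] at hw
      subst hw
      obtain ⟨W, f1, f2, f3, f4, f5⟩ := quad_lemma h.tri hf
      apply ((f1.biUnion (t := fun w => {y | y ∈ T' ∧ Cross y w})
        (fun w hw => h.fin2 w (f2 hw))).union (Set.finite_singleton x)).subset
      rintro y ⟨hy, hc⟩
      rcases f5 y hc with rfl | ⟨w, hw, hcw⟩
      · exact Or.inr rfl
      · left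
        simp only [Set.mem_iUnion]
        exact ⟨w, hw, hy, hcw⟩

lemma FInv.run {T' X S : Set Arc} (h : FInv T' X) {l : List Arc} (hv : Valid S X l) :
    FInv T' (runT X l) := by
  induction l generalizing X with
  | nil => exact h
  | cons x l ih => exact ih (h.mutate hv.1) hv.2.2

lemma insert_one {y : Arc} : ∀ (n : ℕ) (X : Set Arc), IsTriangulation X →
    {x | x ∈ X ∧ Cross x y}.Finite → {x | x ∈ X ∧ Cross x y}.ncard = n →
    ∃ l, Valid {x | Cross x y} X l ∧ y ∈ runT X l := by
  intro n
  induction n using Nat.strong_induction_on with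
  | _ n ih =>
    intro X hX hf hn
    by_cases hy : y ∈ X
    · exact ⟨[], trivial, hy⟩
    obtain ⟨x, z, hxz, hc, hnz⟩ := key_flip' hX y hf hy
    have hmut := hxz.mutable hX
    have hs : {w | w ∈ mutate X x ∧ Cross w y} ⊂ {w | w ∈ X ∧ Cross w y} := by
      constructor
      · rintro w ⟨hw | hw, hcw⟩
        · exact ⟨hw.1, hcw⟩
        · rw [Set.mem_singleton_iff, hxz.flipArc_eq hX] at hw
          exact absurd (hw ▸ hcw) hnz
      · intro hsub
        rcases (hsub ⟨hxz.1, hc⟩).1 with h | h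
        · exact h.2 rfl
        · rw [Set.mem_singleton_iff, hxz.flipArc_eq hX] at h
          exact hnz (h ▸ hc)
    obtain ⟨l, hl1, hl2⟩ := ih _ (hn ▸ Set.ncard_lt_ncard hs hf) (_root_.mutate X x)
      (mutate_tri hX hmut) (hf.subset hs.1) rfl
    exact ⟨x :: l, ⟨hmut, hc, hl1⟩, hl2⟩

lemma insert_many {T' : Set Arc} (hT' : IsTriangulation T') (L : List Arc) (hL : ∀ y ∈ L, y ∈ T') :
    ∀ X, FInv T' X → ∃ l, Valid {x | ∃ y ∈ L, Cross x y} X l ∧ ∀ y ∈ L, y ∈ runT X l := by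
  induction L with
  | nil => exact fun X _ => ⟨[], trivial, by simp⟩
  | cons y L ih =>
    intro X hX
    obtain ⟨l, hl1, hl2⟩ := insert_one (y := y) _ X hX.tri (hX.fin1 y (hL y (by simp))) rfl
    obtain ⟨l', hl1', hl2'⟩ := ih (fun y hy => hL y (by simp [hy])) _ (hX.run hl1)
    refine ⟨l ++ l', valid_append.2 ⟨hl1.mono ?_, hl1'.mono ?_⟩, ?_⟩
    · exact fun x hx => ⟨y, by simp, hx⟩
    · rintro x ⟨y', hy', hc⟩
      exact ⟨y', by simp [hy'], hc⟩
    · rw [runT_append]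
      intro y' hy'
      rcases List.mem_cons.1 hy' with rfl | h
      · refine (keep hl1' ?_).2 hl2
        rintro ⟨w, hw, hc⟩
        exact hT'.1 _ (hL _ (by simp)) _ (hL w (by simp [hw])) hc
      · exact hl2' y' h

lemma insert_set {T' : Set Arc} (hT' : IsTriangulation T') (B : Set Arc) (hB : B ⊆ T')
    (hf : B.Finite) (X : Set Arc) (hX : FInv T' X) :
    ∃ l, Valid {x | ∃ y ∈ B, Cross x y} X l ∧ B ⊆ runT X l := by
  obtain ⟨l, h1, h2⟩ := insert_many hT' hf.toFinset.toList (by simpa using fun y hy => hB hy) X hX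
  refine ⟨l, h1.mono ?_, fun y hy => h2 y (by simpa using hy)⟩
  rintro x ⟨y, hy, hc⟩
  exact ⟨y, by simpa using hy, hc⟩

lemma trace_cell {T' B : Set Arc} {P : Arc → Prop}
    (hB : B ⊆ T')
    (hP : ∀ z h, Cross z h → P h → ¬ P z → ∃ b ∈ B, Cross z b) (l : List Arc) :
    ∀ (X : Set Arc) (h : Arc), IsTriangulation X → B ⊆ X → Valid T'ᶜ X l → h ∈ X → P h →
      P (runA X l h) := by
  induction l with
  | nil => exact fun _ _ _ _ _ _ hp => hp
  | cons x l ih =>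
    intro X h hX hBX hv hh hPh
    have htri := mutate_tri hX hv.1
    have hBX' : B ⊆ mutate X x := fun b hb => Or.inl ⟨hBX hb, fun e => hv.2.1 (e ▸ hB hb)⟩
    refine ih _ _ htri hBX' hv.2.2 (mutArc_mem hh) ?_
    unfold mutArc
    split_ifs with e
    · subst e
      by_contra hnp
      obtain ⟨b, hb, hc⟩ := hP _ _ (mutable_flipOK hX hv.1).2.1 hPh hnp
      exact htri.1 _ (Or.inr rfl) b (hBX' hb) hc
    · exact hPh

lemma finish {T' X : Set Arc} (hT' : IsTriangulation T') (hX : FInv T' X) {g : Arc} (hg : g ∈ X) :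
    ∃ l, Valid T'ᶜ X l ∧ runA X l g ∈ T' := by
  have hf := hX.fin2 g hg
  set V := cellV T' g with hV
  have hVf : V.Finite := cellV_finite hf
  let B : Set Arc := {b | b ∈ T' ∧ (b.src ∈ V ∧ b.tgt ∈ V)}
  let B1 : Set Arc := {b | b ∈ B ∧ ¬ Cross b g}
  have hBf : B.Finite := (arcs_in_finite V hVf).subset (fun b hb => hb.2)
  have hB1f : B1.Finite := hBf.subset (fun b hb => hb.1)
  have hBT : B ⊆ T' := fun b hb => hb.1
  have hB1T : B1 ⊆ T' := fun b hb => hb.1.1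
  have hmono : ∀ C ⊆ T', {x | ∃ y ∈ C, Cross x y} ⊆ T'ᶜ := by
    rintro C hC x ⟨y, hy, hc⟩ hx
    exact hT'.1 x hx y (hC hy) hc
  obtain ⟨l1, v1, s1⟩ := insert_set hT' B1 hB1T hB1f X hX
  have hX1 := hX.run v1
  have hgk := keep v1 (g := g) (by rintro ⟨y, hy, hc⟩; exact hy.2 (cross_symm hc))
  obtain ⟨l2, v2, s2⟩ := insert_set hT' B hBT hBf _ hX1
  have hgX1 := hgk.2 hg
  have hP : ∀ z h : Arc, Cross z h → (h.src ∈ V ∧ h.tgt ∈ V) → ¬ (z.src ∈ V ∧ z.tgt ∈ V) →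
      ∃ b ∈ B1, Cross z b := by
    intro z h hc hh hz
    obtain ⟨b, hb, hbV, hbg, hzb⟩ := cell_sep hT' hf hc hh hz
    exact ⟨b, ⟨⟨hb, hbV⟩, hbg⟩, hzb⟩
  have v2' := v2.mono (hmono B hBT)
  have hr : (runA (runT X l1) l2 g).src ∈ V ∧ (runA (runT X l1) l2 g).tgt ∈ V :=
    trace_cell (P := fun h => h.src ∈ V ∧ h.tgt ∈ V) hB1T hP l2 _ g hX1.tri s1 v2' hgX1
    ⟨⟨g, Or.inl rfl, Or.inl rfl⟩, ⟨g, Or.inl rfl, Or.inr rfl⟩⟩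
  have hrm : runA (runT X l1) l2 g ∈ runT (runT X l1) l2 := runA_mem hgX1
  refine ⟨l1 ++ l2, valid_append.2 ⟨v1.mono (hmono B1 hB1T), v2'⟩, ?_⟩
  rw [runA_append, hgk.1]
  apply hT'.2
  intro y hy hc
  by_cases hyV : y.src ∈ V ∧ y.tgt ∈ V
  · exact (hX1.run v2).tri.1 _ hrm y (s2 ⟨hy, hyV⟩) hc
  · obtain ⟨b, hb, hcb⟩ := hP _ _ (cross_symm hc) hr hyV
    exact hT'.1 y hy b (hB1T hb) hcb

instance : Countable Vtx := by
  have : Function.Injective (fun v : Vtx => (show Option (Option ℤ) from v)) := fun _ _ h => h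
  exact this.countable

instance : Countable Arc := by
  have : Function.Injective (fun w : Arc => (w.src, w.tgt)) := by
    intro x y h
    simp at h
    exact arc_ext h.1 h.2
  exact this.countable

/-- the run along `θ` agrees with a run along a list -/
lemma iter_eq_run (T : Set Arc) (θ : ℕ → Option Arc) (l : List Arc)
    (h : ∀ i (hi : i < l.length), θ i = some l[i]) :
    iterT T θ l.length = runT T l ∧ ∀ g, iterA T θ g l.length = runA T l g := by
  induction l using List.reverseRecOn with
  | nil => exact ⟨rfl, fun _ => rfl⟩
  | append_singleton l x ih =>
    have ih' := ih (by
      intro i hi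
      rw [h i (by simp; omega)]
      simp [List.getElem_append_left hi])
    have hx : θ l.length = some x := by
      rw [h l.length (by simp)]
      simp
    rw [List.length_append]
    refine ⟨?_, fun g => ?_⟩
    · show stepT (iterT T θ l.length) (θ l.length) = _
      rw [hx, ih'.1, runT_append]; rfl
    · show stepA (iterT T θ l.length) (θ l.length) (iterA T θ g l.length) = _
      rw [hx, ih'.1, ih'.2, runA_append]; rfl

lemma iterT_image (T : Set Arc) (θ : ℕ → Option Arc)
    (hm : ∀ i γ, θ i = some γ → IsMutable (iterT T θ i) γ) (n : ℕ) :
    iterT T θ n = (fun g => iterA T θ g n) '' T := by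
  induction n with
  | zero => simp [iterT, iterA]
  | succ n ih =>
    have : iterT T θ (n+1) = stepA (iterT T θ n) (θ n) '' (iterT T θ n) := by
      show stepT (iterT T θ n) (θ n) = _
      cases hθ : θ n with
      | none => exact (Set.image_id (iterT T θ n)).symm
      | some x =>
        have hx := (hm n x hθ).1
        ext w
        constructor
        · rintro (hw | hw)
          · exact ⟨w, hw.1, if_neg hw.2⟩
          · exact ⟨x, hx, by rw [Set.mem_singleton_iff] at hw; rw [hw]; exact if_pos rfl⟩
        · rintro ⟨v, hv, rfl⟩
          exact mutArc_mem hv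
    rw [this]
    nth_rewrite 2 [ih]
    rw [Set.image_image]
    rfl

lemma seqLimit_eq {T : Set Arc} {θ : ℕ → Option Arc} {γ : Arc} {n : ℕ}
    (h : ∀ k, n ≤ k → iterA T θ γ k = iterA T θ γ n) : seqLimit T θ γ = iterA T θ γ n := by
  have hex : ∃ l, ∀ k, l ≤ k → iterA T θ γ k = iterA T θ γ l := ⟨n, h⟩
  unfold seqLimit
  rw [dif_pos hex]
  rw [← h _ (le_max_left n hex.choose)]
  exact (hex.choose_spec _ (le_max_right _ _)).symm

theorem leSc_of_finite_cross {T T' : Set Arc} (hT : IsTriangulation T) (hT' : IsTriangulation T')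
    (h1 : ∀ y ∈ T', {x | x ∈ T ∧ Cross x y}.Finite)
    (h2 : ∀ x ∈ T, {y | y ∈ T' ∧ Cross y x}.Finite) : leSc T T' := by
  have hI : FInv T' T := ⟨hT, h1, h2⟩
  have : Nonempty Arc := ⟨generic⟩
  obtain ⟨e, he⟩ := exists_surjective_nat Arc
  -- extension
  have ext : ∀ (k : ℕ) (l : List Arc), Valid T'ᶜ T l → ∃ l', Valid T'ᶜ T (l ++ l') ∧
      (e k ∈ T' → e k ∈ runT T (l ++ l')) ∧ (e k ∈ T → runA T (l ++ l') (e k) ∈ T') := by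
    intro k l hl
    obtain ⟨la, va, sa⟩ : ∃ la, Valid T'ᶜ (runT T l) la ∧ (e k ∈ T' → e k ∈ runT (runT T l) la) := by
      by_cases hk : e k ∈ T'
      · obtain ⟨la, va, sa⟩ := insert_one (y := e k) _ _ (hI.run hl).tri ((hI.run hl).fin1 _ hk) rfl
        exact ⟨la, va.mono (fun x hx hxT => hT'.1 x hxT _ hk hx), fun _ => sa⟩
      · exact ⟨[], trivial, fun h => absurd h hk⟩
    have hl2 : Valid T'ᶜ T (l ++ la) := valid_append.2 ⟨hl, va⟩
    obtain ⟨lb, vb, sb⟩ : ∃ lb, Valid T'ᶜ (runT T (l ++ la)) lb ∧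
        (e k ∈ T → runA (runT T (l ++ la)) lb (runA T (l ++ la) (e k)) ∈ T') := by
      by_cases hk : e k ∈ T
      · obtain ⟨lb, vb, sb⟩ := finish hT' (hI.run hl2) (runA_mem (l := l ++ la) hk)
        exact ⟨lb, vb, fun _ => sb⟩
      · exact ⟨[], trivial, fun h => absurd h hk⟩
    refine ⟨la ++ lb, ?_, ?_, ?_⟩
    · rw [← List.append_assoc]
      exact valid_append.2 ⟨hl2, vb⟩
    · intro hk
      rw [← List.append_assoc, runT_append]
      refine (keep vb (fun h => h hk)).2 ?_
      rw [runT_append]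
      exact sa hk
    · intro hk
      rw [← List.append_assoc, runA_append]
      exact sb hk
  choose nxt hn1 hn2 hn3 using ext
  let P : ℕ → {l : List Arc // Valid T'ᶜ T l} := fun n =>
    Nat.rec ⟨[], trivial⟩ (fun k p => ⟨p.1 ++ nxt k p.1 p.2, hn1 k p.1 p.2⟩) n
  have hPs : ∀ k, (P (k+1)).1 = (P k).1 ++ nxt k (P k).1 (P k).2 := fun k => rfl
  have hpre : ∀ j k, j ≤ k → (P j).1 <+: (P k).1 := by
    intro j k hjk
    induction hjk with
    | refl => exact List.prefix_refl _
    | step _ ih => exact ih.trans ⟨_, (hPs _).symm⟩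
  let θ : ℕ → Option Arc := fun i =>
    if h : ∃ k, i < (P k).1.length then (P h.choose).1[i]? else none
  have hθ : ∀ k i (hi : i < (P k).1.length), θ i = some (P k).1[i] := by
    intro k i hi
    have hex : ∃ k, i < (P k).1.length := ⟨k, hi⟩
    have : θ i = (P hex.choose).1[i]? := dif_pos hex
    rw [this]
    have hc := hex.choose_spec
    rcases le_total k hex.choose with hle | hle
    · rw [List.getElem?_eq_getElem hc]
      congr 1
      exact ((hpre _ _ hle).getElem hi).symm
    · rw [List.getElem?_eq_getElem hc]
      congr 1
      exact (hpre _ _ hle).getElem hc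
  have hθn : ∀ i, θ i = none ↔ ∀ k, (P k).1.length ≤ i := by
    intro i
    constructor
    · intro h k
      by_contra hcon
      rw [hθ k i (by omega)] at h
      simp at h
    · intro h
      exact dif_neg (by push Not; exact h)
  have hrun : ∀ k, iterT T θ (P k).1.length = runT T (P k).1 ∧
      ∀ g, iterA T θ g (P k).1.length = runA T (P k).1 g := fun k =>
    iter_eq_run T θ _ (fun i hi => hθ k i hi)
  have hmut : ∀ i γ, θ i = some γ → IsMutable (iterT T θ i) γ ∧ γ ∉ T' := by
    intro i γ hi
    have hex : ∃ k, i < (P k).1.length := by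
      by_contra hcon
      push Not at hcon
      rw [(hθn i).2 hcon] at hi
      simp at hi
    obtain ⟨k, hk⟩ := hex
    have hγ : (P k).1[i] = γ := by
      rw [hθ k i hk] at hi
      simpa using hi
    have hsplit : (P k).1 = (P k).1.take i ++ (γ :: (P k).1.drop (i+1)) := by
      rw [← hγ, List.cons_getElem_drop_succ, List.take_append_drop]
    have hv := (P k).2
    rw [hsplit] at hv
    have hv' := (valid_append.1 hv).2
    have hlen : ((P k).1.take i).length = i := by simp; omega
    have := (iter_eq_run T θ ((P k).1.take i) (by
      intro j hj
      rw [hθ k j (by omega)]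
      simp)).1
    rw [hlen] at this
    rw [this]
    exact ⟨hv'.1, hv'.2.1⟩
  have hstable : ∀ g n, iterA T θ g n ∈ T' → ∀ k, n ≤ k → iterA T θ g k = iterA T θ g n := by
    intro g n hn k hk
    induction hk with
    | refl => rfl
    | step hk ih =>
      rename_i m
      show stepA (iterT T θ m) (θ m) (iterA T θ g m) = _
      rw [ih]
      cases hx : θ m with
      | none => rfl
      | some x =>
        have hne : iterA T θ g n ≠ x := fun e => (hmut m x hx).2 (e ▸ hn)
        exact if_neg hne
  have hfin : ∀ g ∈ T, ∃ n, iterA T θ g n ∈ T' := by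
    intro g hg
    obtain ⟨k, rfl⟩ := he g
    refine ⟨(P (k+1)).1.length, ?_⟩
    rw [(hrun (k+1)).2]
    exact hn3 k _ _ hg
  refine ⟨θ, ⟨?_, fun i γ h => (hmut i γ h).1, ?_⟩, ?_⟩
  · intro i hi
    rw [hθn] at hi ⊢
    exact fun k => (hi k).trans (Nat.le_succ i)
  · intro g hg
    obtain ⟨n, hn⟩ := hfin g hg
    exact ⟨n, hstable g n hn⟩
  · apply Set.Subset.antisymm
    · rintro _ ⟨g, hg, rfl⟩
      obtain ⟨n, hn⟩ := hfin g hg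
      rw [seqLimit_eq (hstable g n hn)]
      exact hn
    · intro y hy
      obtain ⟨k, rfl⟩ := he y
      have hm : e k ∈ iterT T θ (P (k+1)).1.length := by
        rw [(hrun (k+1)).1]
        exact hn2 k _ _ hy
      rw [iterT_image T θ (fun i γ h => (hmut i γ h).1)] at hm
      obtain ⟨g, hg, hgk⟩ := hm
      refine ⟨g, hg, ?_⟩
      simp only at hgk
      rw [seqLimit_eq (hstable g _ (hgk.symm ▸ hy)), hgk]

lemma vcases (v : Vtx) : v = vBot ∨ v = vTop ∨ ∃ m, v = vInt m := by
  induction v using WithBot.recBotCoe with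
  | bot => exact Or.inl rfl
  | coe v =>
    induction v using WithTop.recTopCoe with
    | top => exact Or.inr (Or.inl rfl)
    | coe m => exact Or.inr (Or.inr ⟨m, rfl⟩)

@[simp] lemma vInt_lt (a b : ℤ) : vInt a < vInt b ↔ a < b := by simp [vInt]
@[simp] lemma vInt_le (a b : ℤ) : vInt a ≤ vInt b ↔ a ≤ b := by simp [vInt]
@[simp] lemma vInt_eq (a b : ℤ) : vInt a = vInt b ↔ a = b := by simp [vInt]
@[simp] lemma not_lt_vBot (v : Vtx) : ¬ v < vBot := by simp [vBot]
@[simp] lemma vTop_eq_top : (⊤ : Vtx) = vTop := rfl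
@[simp] lemma not_vTop_lt (v : Vtx) : ¬ vTop < v := by
  rw [← vTop_eq_top]; exact not_top_lt
@[simp] lemma le_vTop (v : Vtx) : v ≤ vTop := not_lt.1 (not_vTop_lt v)
@[simp] lemma vBot_le (v : Vtx) : vBot ≤ v := not_lt.1 (not_lt_vBot v)
attribute [simp] vInt_lt_vTop vBot_lt_vInt vBot_lt_vTop vTop_ne_vInt vBot_ne_vInt
@[simp] lemma vInt_ne_vTop (m : ℤ) : vInt m ≠ vTop := (vTop_ne_vInt m).symm
@[simp] lemma vInt_ne_vBot (m : ℤ) : vInt m ≠ vBot := (vBot_ne_vInt m).symm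
@[simp] lemma vTop_ne_vBot : vTop ≠ vBot := vBot_lt_vTop.ne'
@[simp] lemma vBot_ne_vTop : vBot ≠ vTop := vBot_lt_vTop.ne

lemma HasArc.lt {X : Set Arc} {a b : Vtx} (h : HasArc X a b) : a < b := by
  obtain ⟨x, -, rfl, rfl⟩ := h; exact x.lt
lemma HasArc.sep {X : Set Arc} {a b : ℤ} (h : HasArc X (vInt a) (vInt b)) : a + 2 ≤ b := by
  obtain ⟨x, -, h1, h2⟩ := h; exact x.sep _ _ h1 h2
lemma nc {X : Set Arc} (hX : IsTriangulation X) {a b c d : Vtx} (h : HasArc X a b)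
    (h' : HasArc X c d) : ¬ Cr a b c d := by
  obtain ⟨x, hx, rfl, rfl⟩ := h
  obtain ⟨y, hy, rfl, rfl⟩ := h'
  exact hX.1 x hx y hy
lemma hasArc_adic {X : Set Arc} {m : ℤ} : HasArc X vBot (vInt m) ↔ adic m ∈ X := by
  constructor
  · rintro ⟨x, hx, h1, h2⟩
    have : x = adic m := arc_ext h1 h2
    exact this ▸ hx
  · exact fun h => ⟨_, h, rfl, rfl⟩
lemma hasArc_prufer {X : Set Arc} {m : ℤ} : HasArc X (vInt m) vTop ↔ prufer m ∈ X := by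
  constructor
  · rintro ⟨x, hx, h1, h2⟩
    have : x = prufer m := arc_ext h1 h2
    exact this ▸ hx
  · exact fun h => ⟨_, h, rfl, rfl⟩
lemma adic_of {X : Set Arc} (hX : IsTriangulation X) {m : ℤ}
    (h : ∀ c d, HasArc X c d → ¬ Cr vBot (vInt m) c d) : HasArc X vBot (vInt m) :=
  hasArc_adic.2 (hX.2 _ (fun x hx => h _ _ ⟨x, hx, rfl, rfl⟩))
lemma prufer_of {X : Set Arc} (hX : IsTriangulation X) {m : ℤ}
    (h : ∀ c d, HasArc X c d → ¬ Cr (vInt m) vTop c d) : HasArc X (vInt m) vTop :=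
  hasArc_prufer.2 (hX.2 _ (fun x hx => h _ _ ⟨x, hx, rfl, rfl⟩))

def LeftF (X : Set Arc) (a : Vtx) : Prop :=
  ∀ N : ℤ, ∃ p ≤ N, HasArc X (vInt p) a ∨ HasArc X a (vInt p)
def RightF (X : Set Arc) (a : Vtx) : Prop :=
  ∀ N : ℤ, ∃ p ≥ N, HasArc X (vInt p) a ∨ HasArc X a (vInt p)

lemma LeftF.int {X : Set Arc} {n : ℤ} (h : LeftF X (vInt n)) (N : ℤ) :
    ∃ p ≤ N, HasArc X (vInt p) (vInt n) := by
  obtain ⟨p, hp, h | h⟩ := h (min N n)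
  · exact ⟨p, by omega, h⟩
  · have := h.sep; omega
lemma LeftF.bot {X : Set Arc} (h : LeftF X vBot) (N : ℤ) :
    ∃ p ≤ N, HasArc X vBot (vInt p) := by
  obtain ⟨p, hp, h | h⟩ := h N
  · exact absurd h.lt (by simp)
  · exact ⟨p, hp, h⟩
lemma LeftF.top {X : Set Arc} (h : LeftF X vTop) (N : ℤ) :
    ∃ p ≤ N, HasArc X (vInt p) vTop := by
  obtain ⟨p, hp, h | h⟩ := h N
  · exact ⟨p, hp, h⟩
  · exact absurd h.lt (by simp)
lemma RightF.int {X : Set Arc} {n : ℤ} (h : RightF X (vInt n)) (N : ℤ) :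
    ∃ p ≥ N, HasArc X (vInt n) (vInt p) := by
  obtain ⟨p, hp, h | h⟩ := h (max N n)
  · have := h.sep; omega
  · exact ⟨p, by omega, h⟩
lemma RightF.bot {X : Set Arc} (h : RightF X vBot) (N : ℤ) :
    ∃ p ≥ N, HasArc X vBot (vInt p) := by
  obtain ⟨p, hp, h | h⟩ := h N
  · exact absurd h.lt (by simp)
  · exact ⟨p, hp, h⟩
lemma RightF.top {X : Set Arc} (h : RightF X vTop) (N : ℤ) :
    ∃ p ≥ N, HasArc X (vInt p) vTop := by
  obtain ⟨p, hp, h | h⟩ := h N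
  · exact ⟨p, hp, h⟩
  · exact absurd h.lt (by simp)

lemma inf_below {S : Set ℤ} {n : ℤ} (hb : ∀ p ∈ S, p ≤ n) :
    S.Infinite ↔ ∀ N : ℤ, ∃ p ≤ N, p ∈ S := by
  constructor
  · intro h N
    by_contra hcon
    push Not at hcon
    apply h
    apply (Set.finite_Icc N n).subset
    intro p hp
    refine ⟨?_, hb p hp⟩
    by_contra hlt
    exact hcon p (by omega) hp
  · intro h
    apply Set.infinite_of_not_bddBelow
    rintro ⟨M, hM⟩
    obtain ⟨p, hp, hpS⟩ := h (M - 1)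
    have := hM hpS
    omega
lemma inf_above {S : Set ℤ} {n : ℤ} (hb : ∀ p ∈ S, n ≤ p) :
    S.Infinite ↔ ∀ N : ℤ, ∃ p ≥ N, p ∈ S := by
  constructor
  · intro h N
    by_contra hcon
    push Not at hcon
    apply h
    apply (Set.finite_Icc n N).subset
    intro p hp
    refine ⟨hb p hp, ?_⟩
    by_contra hlt
    exact hcon p (by omega) hp
  · intro h
    apply Set.infinite_of_not_bddAbove
    rintro ⟨M, hM⟩
    obtain ⟨p, hp, hpS⟩ := h (M + 1)
    have := hM hpS
    omega

lemma leftF_iff {X : Set Arc} {a : Vtx} : LeftFountain X a ↔ LeftF X a := by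
  have e1 : ∀ n, LeftFountainInt X n ↔ LeftF X (vInt n) := by
    intro n
    unfold LeftFountainInt
    rw [inf_below (n := n) (by intro p hp; have := HasArc.sep hp; omega)]
    constructor
    · intro h N
      obtain ⟨p, hp, h⟩ := h N
      exact ⟨p, hp, Or.inl h⟩
    · exact fun h N => h.int N
  have e2 : {p : ℤ | p ≤ 0 ∧ prufer p ∈ X}.Infinite ↔ LeftF X vTop := by
    rw [inf_below (n := 0) (fun p hp => hp.1)]
    constructor
    · intro h N
      obtain ⟨p, hp, h⟩ := h N
      exact ⟨p, hp, Or.inl (hasArc_prufer.2 h.2)⟩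
    · intro h N
      obtain ⟨p, hp, h⟩ := h.top (min N 0)
      exact ⟨p, by omega, by omega, hasArc_prufer.1 h⟩
  have e3 : {p : ℤ | p ≤ 0 ∧ adic p ∈ X}.Infinite ↔ LeftF X vBot := by
    rw [inf_below (n := 0) (fun p hp => hp.1)]
    constructor
    · intro h N
      obtain ⟨p, hp, h⟩ := h N
      exact ⟨p, hp, Or.inr (hasArc_adic.2 h.2)⟩
    · intro h N
      obtain ⟨p, hp, h⟩ := h.bot (min N 0)
      exact ⟨p, by omega, by omega, hasArc_adic.1 h⟩
  unfold LeftFountain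
  rw [e2, e3]
  simp only [e1]
  rcases vcases a with rfl | rfl | ⟨m, rfl⟩ <;> simp

lemma rightF_iff {X : Set Arc} {a : Vtx} : RightFountain X a ↔ RightF X a := by
  have e1 : ∀ n, RightFountainInt X n ↔ RightF X (vInt n) := by
    intro n
    unfold RightFountainInt
    rw [inf_above (n := n) (by intro p hp; have := HasArc.sep hp; omega)]
    constructor
    · intro h N
      obtain ⟨p, hp, h⟩ := h N
      exact ⟨p, hp, Or.inr h⟩
    · exact fun h N => h.int N
  have e2 : {p : ℤ | 0 ≤ p ∧ prufer p ∈ X}.Infinite ↔ RightF X vTop := by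
    rw [inf_above (n := 0) (fun p hp => hp.1)]
    constructor
    · intro h N
      obtain ⟨p, hp, h⟩ := h N
      exact ⟨p, hp, Or.inl (hasArc_prufer.2 h.2)⟩
    · intro h N
      obtain ⟨p, hp, h⟩ := h.top (max N 0)
      exact ⟨p, by omega, by omega, hasArc_prufer.1 h⟩
  have e3 : {p : ℤ | 0 ≤ p ∧ adic p ∈ X}.Infinite ↔ RightF X vBot := by
    rw [inf_above (n := 0) (fun p hp => hp.1)]
    constructor
    · intro h N
      obtain ⟨p, hp, h⟩ := h N
      exact ⟨p, hp, Or.inr (hasArc_adic.2 h.2)⟩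
    · intro h N
      obtain ⟨p, hp, h⟩ := h.bot (max N 0)
      exact ⟨p, by omega, by omega, hasArc_adic.1 h⟩
  unfold RightFountain
  rw [e2, e3]
  simp only [e1]
  rcases vcases a with rfl | rfl | ⟨m, rfl⟩ <;> simp

/-! reflection -/
def rv : Vtx → Vtx
  | none => vTop
  | some none => vBot
  | some (some m) => vInt (-m)

@[simp] lemma rv_bot : rv vBot = vTop := rfl
@[simp] lemma rv_top : rv vTop = vBot := rfl
@[simp] lemma rv_int (m : ℤ) : rv (vInt m) = vInt (-m) := rfl
@[simp] lemma rv_rv (v : Vtx) : rv (rv v) = v := by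
  rcases vcases v with rfl | rfl | ⟨m, rfl⟩ <;> simp
@[simp] lemma rv_lt (v w : Vtx) : rv v < rv w ↔ w < v := by
  rcases vcases v with rfl | rfl | ⟨m, rfl⟩ <;> rcases vcases w with rfl | rfl | ⟨n, rfl⟩ <;> simp
lemma rv_eq {v w : Vtx} : rv v = w ↔ v = rv w := by
  constructor
  · rintro rfl; simp
  · rintro rfl; simp

def Arc.rev (x : Arc) : Arc := ⟨rv x.tgt, rv x.src, by simpa using x.lt, by
  intro m n h1 h2
  rw [rv_eq] at h1 h2
  simp at h1 h2
  have := x.sep _ _ h2 h1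
  omega⟩

lemma rev_rev (x : Arc) : x.rev.rev = x := arc_ext (by simp [Arc.rev]) (by simp [Arc.rev])

lemma cross_rev (x y : Arc) : Cross x.rev y.rev ↔ Cross x y := by
  simp only [Cross, Arc.rev, rv_lt]; tauto

def revS (X : Set Arc) : Set Arc := {x | x.rev ∈ X}

lemma mem_revS {X : Set Arc} {x : Arc} : x ∈ revS X ↔ x.rev ∈ X := Iff.rfl

lemma revS_tri {X : Set Arc} (hX : IsTriangulation X) : IsTriangulation (revS X) := by
  constructor
  · intro x hx y hy hc
    exact hX.1 _ hx _ hy ((cross_rev x y).2 hc)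
  · intro g hg
    apply hX.2
    intro x hx hc
    apply hg x.rev (by rw [mem_revS, rev_rev]; exact hx)
    rwa [← cross_rev, rev_rev]

lemma hasArc_rev {X : Set Arc} {a b : Vtx} : HasArc (revS X) a b ↔ HasArc X (rv b) (rv a) := by
  constructor
  · rintro ⟨x, hx, rfl, rfl⟩
    exact ⟨x.rev, hx, rfl, rfl⟩
  · rintro ⟨x, hx, h1, h2⟩
    refine ⟨x.rev, ?_, ?_, ?_⟩
    · rw [mem_revS, rev_rev]; exact hx
    · simp [Arc.rev, h2]
    · simp [Arc.rev, h1]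

lemma leftF_rev {X : Set Arc} {a : Vtx} : LeftF (revS X) (rv a) ↔ RightF X a := by
  simp only [LeftF, RightF, hasArc_rev, rv_rv, rv_int]
  constructor
  · intro h N
    obtain ⟨p, hp, h⟩ := h (-N)
    exact ⟨-p, by omega, h.symm⟩
  · intro h N
    obtain ⟨p, hp, h⟩ := h (-N)
    exact ⟨-p, by omega, by simpa using h.symm⟩

lemma revS_diff_finite {X Y : Set Arc} (h : (X \ Y).Finite) : (revS X \ revS Y).Finite := by
  apply (h.image Arc.rev).subset
  rintro x ⟨hx, hy⟩
  exact ⟨x.rev, ⟨hx, hy⟩, rev_rev x⟩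

/-! existence of fountains -/
lemma least {Q : ℤ → Prop} (h : ∃ m, Q m) (hb : ∃ N, ∀ p ≤ N, ¬ Q p) :
    ∃ m, Q m ∧ ∀ p < m, ¬ Q p := by
  obtain ⟨N, hN⟩ := hb
  obtain ⟨m, hm, hl⟩ := Int.exists_least_of_bdd (P := Q) ⟨N, fun z hz => by
    by_contra hlt; exact hN z (by omega) hz⟩ h
  exact ⟨m, hm, fun p hp hQ => by have := hl p hQ; omega⟩

lemma exists_leftF {X : Set Arc} (hX : IsTriangulation X)
    (h : (∃ m, HasArc X vBot (vInt m)) ∨ ∃ m, HasArc X (vInt m) vTop) : ∃ a, LeftF X a := by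
  by_contra hno
  push Not at hno
  have hb : ∀ a, ∃ N : ℤ, ∀ p ≤ N, ¬ HasArc X (vInt p) a ∧ ¬ HasArc X a (vInt p) := by
    intro a
    have := hno a
    unfold LeftF at this
    push Not at this
    exact this
  have leftmost : ∀ m : ℤ, ∃ p < m, (p = m - 1 ∨ HasArc X (vInt p) (vInt m)) ∧
      ∀ c < p, ¬ HasArc X (vInt c) (vInt m) := by
    intro m
    obtain ⟨N, hN⟩ := hb (vInt m)
    obtain ⟨p, hp, hl⟩ := least (Q := fun p => p = m - 1 ∨ HasArc X (vInt p) (vInt m))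
      ⟨m - 1, Or.inl rfl⟩ ⟨min N (m - 2), by
        rintro p hp (h | h)
        · omega
        · exact (hN p (by omega)).1 h⟩
    refine ⟨p, ?_, hp, fun c hc h => hl c hc (Or.inr h)⟩
    rcases hp with h | h
    · omega
    · have := h.sep; omega
  have hA : ¬ ∃ m, HasArc X vBot (vInt m) := by
    intro hA
    obtain ⟨N, hN⟩ := hb vBot
    obtain ⟨m, hm, hl⟩ := least hA ⟨N, fun p hp => (hN p hp).2⟩
    obtain ⟨p, hpm, hp, hpl⟩ := leftmost m
    refine hl p hpm (adic_of hX ?_)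
    intro c d hcd hcr
    have n1 := nc hX hm hcd
    have n2 := fun h => nc hX h hcd (a := vInt p) (b := vInt m)
    rcases vcases c with rfl | rfl | ⟨c, rfl⟩ <;> rcases vcases d with rfl | rfl | ⟨d, rfl⟩ <;>
      simp [Cr] at hcr n1 n2
    · omega
    · by_cases hd : d = m
      · subst hd
        exact hpl c (by omega) hcd
      · rcases hp with hp | hp
        · omega
        · have := n2 hp; omega
  have hB : ∃ m, HasArc X (vInt m) vTop := h.resolve_left hA
  obtain ⟨N, hN⟩ := hb vTop
  obtain ⟨m, hm, hl⟩ := least hB ⟨N, fun p hp => (hN p hp).1⟩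
  obtain ⟨p, hpm, hp, hpl⟩ := leftmost m
  refine hl p hpm (prufer_of hX ?_)
  intro c d hcd hcr
  have n1 := nc hX hm hcd
  have n2 := fun h => nc hX h hcd (a := vInt p) (b := vInt m)
  rcases vcases c with rfl | rfl | ⟨c, rfl⟩ <;> rcases vcases d with rfl | rfl | ⟨d, rfl⟩ <;>
    simp [Cr] at hcr n1 n2
  · exact hA ⟨d, hcd⟩
  · by_cases hd : d = m
    · subst hd
      exact hpl c (by omega) hcd
    · rcases hp with hp | hp
      · omega
      · have := n2 hp; omega

lemma exists_rightF {X : Set Arc} (hX : IsTriangulation X)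
    (h : (∃ m, HasArc X vBot (vInt m)) ∨ ∃ m, HasArc X (vInt m) vTop) : ∃ a, RightF X a := by
  obtain ⟨a, ha⟩ := exists_leftF (revS_tri hX) (by
    rcases h with ⟨m, h⟩ | ⟨m, h⟩
    · exact Or.inr ⟨-m, by rw [hasArc_rev]; simpa using h⟩
    · exact Or.inl ⟨-m, by rw [hasArc_rev]; simpa using h⟩)
  exact ⟨rv a, by rw [← leftF_rev, rv_rv]; exact ha⟩

lemma exists_inf_of_not_lf {X : Set Arc} (hX : IsTriangulation X) (h : ¬ LocallyFin X) :
    (∃ m, HasArc X vBot (vInt m)) ∨ ∃ m, HasArc X (vInt m) vTop := by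
  by_contra hno
  push Not at hno
  obtain ⟨hA, hB⟩ := hno
  apply h
  intro v
  have hgen : ∀ x ∈ X, (x.src = vBot ∨ x.tgt = vBot ∨ x.src = vTop ∨ x.tgt = vTop) → x = generic := by
    intro x hx hc
    have hl := x.lt
    have h1 : HasArc X x.src x.tgt := ⟨x, hx, rfl, rfl⟩
    rcases vcases x.src with e1 | e1 | ⟨c, e1⟩ <;> rcases vcases x.tgt with e2 | e2 | ⟨d, e2⟩ <;>
      rw [e1, e2] at hl h1 <;> simp [e1, e2] at hl hc
    · exact arc_ext e1 e2
    · exact absurd h1 (hA d)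
    · exact absurd h1 (hB c)
  rcases vcases v with rfl | rfl | ⟨n, rfl⟩
  · exact (Set.finite_singleton generic).subset (fun x hx => hgen x hx.1 (by have := hx.2; tauto))
  · exact (Set.finite_singleton generic).subset (fun x hx => hgen x hx.1 (by have := hx.2; tauto))
  have f1 : {p : ℤ | HasArc X (vInt p) (vInt n)}.Finite := by
    by_contra hinf
    have hi := (inf_below (n := n) (fun p hp => by have := HasArc.sep hp; omega)).1 hinf
    apply hA n
    apply adic_of hX
    intro c d hcd hcr
    rcases vcases c with rfl | rfl | ⟨c, rfl⟩
    · simp [Cr] at hcr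
    · exact absurd hcd.lt (by simp)
    · obtain ⟨p, hp, hpn⟩ := hi (c - 1)
      have n1 := nc hX hpn hcd
      rcases vcases d with rfl | rfl | ⟨d, rfl⟩ <;> simp [Cr] at hcr n1 <;> omega
  have f2 : {p : ℤ | HasArc X (vInt n) (vInt p)}.Finite := by
    by_contra hinf
    have hi := (inf_above (n := n) (fun p hp => by have := HasArc.sep hp; omega)).1 hinf
    apply hB n
    apply prufer_of hX
    intro c d hcd hcr
    rcases vcases d with rfl | rfl | ⟨d, rfl⟩
    · exact absurd hcd.lt (by simp)
    · simp [Cr] at hcr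
    · obtain ⟨p, hp, hpn⟩ := hi (d + 1)
      have n1 := nc hX hpn hcd
      rcases vcases c with rfl | rfl | ⟨c, rfl⟩ <;> simp [Cr] at hcr n1 <;> omega
  apply (arcs_in_finite ({vBot, vTop, vInt n} ∪ vInt '' {p : ℤ | HasArc X (vInt p) (vInt n)} ∪
    vInt '' {p : ℤ | HasArc X (vInt n) (vInt p)})
    ((((Set.finite_singleton _).insert _).insert _).union (f1.image _) |>.union (f2.image _))).subset
  rintro x ⟨hx, hv⟩
  have h1 : HasArc X x.src x.tgt := ⟨x, hx, rfl, rfl⟩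
  have hs : ∀ v, v = vBot ∨ v = vTop ∨ v = vInt n ∨ (∃ m, v = vInt m ∧ HasArc X (vInt m) (vInt n)) ∨
    (∃ m, v = vInt m ∧ HasArc X (vInt n) (vInt m)) → v ∈ ({vBot, vTop, vInt n} ∪ vInt '' {p : ℤ | HasArc X (vInt p) (vInt n)} ∪
    vInt '' {p : ℤ | HasArc X (vInt n) (vInt p)} : Set Vtx) := by
    rintro v (h | h | h | ⟨m, rfl, h⟩ | ⟨m, rfl, h⟩)
    · simp [h]
    · simp [h]
    · simp [h]
    · exact Or.inl (Or.inr ⟨m, h, rfl⟩)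
    · exact Or.inr ⟨m, h, rfl⟩
  rcases hv with e | e
  · refine ⟨hs _ (by tauto), hs _ ?_⟩
    rcases vcases x.tgt with e2 | e2 | ⟨d, e2⟩
    · tauto
    · tauto
    · rw [e, e2] at h1
      exact Or.inr (Or.inr (Or.inr (Or.inr ⟨d, e2, h1⟩)))
  · refine ⟨hs _ ?_, hs _ (by tauto)⟩
    rcases vcases x.src with e2 | e2 | ⟨d, e2⟩
    · tauto
    · tauto
    · rw [e, e2] at h1
      exact Or.inr (Or.inr (Or.inr (Or.inl ⟨d, e2, h1⟩)))

lemma not_lf_of_leftF {X : Set Arc} {a : Vtx} (h : LeftF X a) : ¬ LocallyFin X := by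
  intro hl
  have hf := hl a
  have hfin : ∀ f : Arc → Vtx, {p : ℤ | ∃ x, (x ∈ X ∧ (x.src = a ∨ x.tgt = a)) ∧ f x = vInt p}.Finite := by
    intro f
    apply Set.Finite.of_finite_image (f := vInt)
    · apply (hf.image f).subset
      rintro _ ⟨p, ⟨x, hx, e⟩, rfl⟩
      exact ⟨x, hx, e⟩
    · intro p _ q _ e
      simpa using e
  obtain ⟨M, hM⟩ := ((hfin Arc.src).union (hfin Arc.tgt)).bddBelow
  obtain ⟨p, hp, h | h⟩ := h (M - 1)
  · obtain ⟨x, hx, h1, h2⟩ := h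
    have := hM (Or.inl ⟨x, ⟨hx, Or.inr h2⟩, h1⟩ : p ∈ _)
    omega
  · obtain ⟨x, hx, h1, h2⟩ := h
    have := hM (Or.inr ⟨x, ⟨hx, Or.inl h1⟩, h2⟩ : p ∈ _)
    omega

lemma LeftF.transfer {T X : Set Arc} {a : Vtx} (hf : (T \ X).Finite) (h : LeftF T a) :
    LeftF X a := by
  have hfin : ∀ f : Arc → Vtx, {p : ℤ | ∃ x ∈ T \ X, f x = vInt p}.Finite := by
    intro f
    apply Set.Finite.of_finite_image (f := vInt)
    · apply (hf.image f).subset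
      rintro _ ⟨p, ⟨x, hx, e⟩, rfl⟩
      exact ⟨x, hx, e⟩
    · intro p _ q _ e
      simpa using e
  obtain ⟨M, hM⟩ := ((hfin Arc.src).union (hfin Arc.tgt)).bddBelow
  intro N
  obtain ⟨p, hp, h⟩ := h (min N (M - 1))
  refine ⟨p, by omega, h.imp ?_ ?_⟩
  · rintro ⟨x, hx, h1, h2⟩
    refine ⟨x, ?_, h1, h2⟩
    by_contra hxX
    have := hM (Or.inl ⟨x, ⟨hx, hxX⟩, h1⟩ : p ∈ _)
    omega
  · rintro ⟨x, hx, h1, h2⟩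
    refine ⟨x, ?_, h1, h2⟩
    by_contra hxX
    have := hM (Or.inr ⟨x, ⟨hx, hxX⟩, h2⟩ : p ∈ _)
    omega

def NearBy (A B : Set Arc) : Prop :=
  ∀ g ∈ B, ∃ X, IsTriangulation X ∧ (A \ X).Finite ∧ (X \ A).Finite ∧ g ∈ X

lemma nearBy_of_leSc {T T' : Set Arc} (hT : IsTriangulation T) (h : leSc T T') : NearBy T T' := by
  obtain ⟨θ, ⟨-, hm, hs⟩, rfl⟩ := h
  rintro _ ⟨g, hg, rfl⟩
  obtain ⟨l, hl⟩ := hs g hg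
  have key : ∀ k, IsTriangulation (iterT T θ k) ∧ (T \ iterT T θ k).Finite ∧
      (iterT T θ k \ T).Finite := by
    intro k
    induction k with
    | zero => exact ⟨hT, by simp [iterT], by simp [iterT]⟩
    | succ k ih =>
      have e : iterT T θ (k+1) = stepT (iterT T θ k) (θ k) := rfl
      cases hθ : θ k with
      | none => rw [e, hθ]; exact ih
      | some x =>
        rw [e, hθ]
        show IsTriangulation (mutate (iterT T θ k) x) ∧ _
        refine ⟨mutate_tri ih.1 (hm k x hθ), ?_, ?_⟩
        · apply (ih.2.1.union (Set.finite_singleton x)).subset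
          rintro w ⟨hw, hw'⟩
          by_cases hx : w = x
          · exact Or.inr hx
          · exact Or.inl ⟨hw, fun h => hw' (Or.inl ⟨h, hx⟩)⟩
        · apply (ih.2.2.union (Set.finite_singleton (flipArc (iterT T θ k) x))).subset
          rintro w ⟨hw | hw, hw'⟩
          · exact Or.inl ⟨hw.1, hw'⟩
          · exact Or.inr hw
  refine ⟨iterT T θ l, (key l).1, (key l).2.1, (key l).2.2, ?_⟩
  rw [seqLimit_eq hl, iterT_image T θ hm l]
  exact ⟨g, hg, rfl⟩

lemma NearBy.rev {A B : Set Arc} (h : NearBy A B) : NearBy (revS A) (revS B) := by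
  intro g hg
  obtain ⟨X, h1, h2, h3, h4⟩ := h _ hg
  exact ⟨revS X, revS_tri h1, revS_diff_finite h2, revS_diff_finite h3, h4⟩

lemma adic_of_leftF {T : Set Arc} (hT : IsTriangulation T) {n : ℤ} (h : LeftF T (vInt n)) :
    HasArc T vBot (vInt n) := by
  apply adic_of hT
  intro c d hcd hcr
  rcases vcases c with rfl | rfl | ⟨c, rfl⟩
  · simp [Cr] at hcr
  · simp [Cr] at hcr
  obtain ⟨p, hp, h⟩ := h.int (c - 1)
  apply nc hT h hcd
  simp [Cr] at hcr ⊢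
  left
  exact ⟨by omega, hcr⟩

lemma nearBy_hasArc {A B : Set Arc} (h : NearBy A B) {c d : Vtx} (hB : HasArc B c d) {a : Vtx}
    (hA : LeftF A a) : ∃ X, IsTriangulation X ∧ HasArc X c d ∧ LeftF X a := by
  obtain ⟨g, hg, h1, h2⟩ := hB
  obtain ⟨X, hX, hf, -, hgX⟩ := h g hg
  exact ⟨X, hX, ⟨g, hgX, h1, h2⟩, hA.transfer hf⟩

lemma no_adic_int {A B : Set Arc} (h : NearBy A B) {n m : ℤ} (hA : LeftF A (vInt n))
    (hB : HasArc B vBot (vInt m)) : n ≤ m := by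
  by_contra hlt
  obtain ⟨X, hX, h1, h2⟩ := nearBy_hasArc h hB hA
  obtain ⟨p, hp, h3⟩ := h2.int (m - 1)
  apply nc hX h1 h3
  simp [Cr]; omega

lemma no_prufer_int {A B : Set Arc} (h : NearBy A B) {n m : ℤ} (hA : LeftF A (vInt n))
    (hB : HasArc B (vInt m) vTop) : n ≤ m := by
  by_contra hlt
  obtain ⟨X, hX, h1, h2⟩ := nearBy_hasArc h hB hA
  obtain ⟨p, hp, h3⟩ := h2.int (m - 1)
  apply nc hX h1 h3
  simp [Cr]; omega

lemma no_adic_top {A B : Set Arc} (h : NearBy A B) {m : ℤ} (hA : LeftF A vTop)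
    (hB : HasArc B vBot (vInt m)) : False := by
  obtain ⟨X, hX, h1, h2⟩ := nearBy_hasArc h hB hA
  obtain ⟨p, hp, h3⟩ := h2.top (m - 1)
  apply nc hX h1 h3
  simp [Cr]; omega

lemma leftF_unique {T T' : Set Arc} (hT : IsTriangulation T) (hT' : IsTriangulation T')
    (h : NearBy T T') (h' : NearBy T' T) {a a' : Vtx} (ha : LeftF T a) (ha' : LeftF T' a') :
    a = a' := by
  rcases vcases a with rfl | rfl | ⟨n, rfl⟩ <;> rcases vcases a' with rfl | rfl | ⟨n', rfl⟩
  · rfl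
  · obtain ⟨p, hp, hh⟩ := ha.bot 0
    exact (no_adic_top h' ha' hh).elim
  · obtain ⟨p, hp, hh⟩ := ha.bot (n' - 1)
    have := no_adic_int h' ha' hh; omega
  · obtain ⟨p, hp, hh⟩ := ha'.bot 0
    exact (no_adic_top h ha hh).elim
  · rfl
  · obtain ⟨p, hp, hh⟩ := ha.top (n' - 1)
    have := no_prufer_int h' ha' hh; omega
  · obtain ⟨p, hp, hh⟩ := ha'.bot (n - 1)
    have := no_adic_int h ha hh; omega
  · obtain ⟨p, hp, hh⟩ := ha'.top (n - 1)
    have := no_prufer_int h ha hh; omega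
  · have h1 := no_adic_int h ha (adic_of_leftF hT' ha')
    have h2 := no_adic_int h' ha' (adic_of_leftF hT ha)
    rw [le_antisymm h1 h2]

lemma rightF_unique {T T' : Set Arc} (hT : IsTriangulation T) (hT' : IsTriangulation T')
    (h : NearBy T T') (h' : NearBy T' T) {a a' : Vtx} (ha : RightF T a) (ha' : RightF T' a') :
    a = a' := by
  have := leftF_unique (revS_tri hT) (revS_tri hT') h.rev h'.rev (leftF_rev.2 ha) (leftF_rev.2 ha')
  rw [rv_eq, rv_rv] at this
  exact this

lemma lf_of_nearBy {T T' : Set Arc} (hT' : IsTriangulation T') (h : NearBy T T')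
    (hl : LocallyFin T) : LocallyFin T' := by
  by_contra hn
  have key : ∀ X, IsTriangulation X → (X \ T).Finite →
      ((∃ m, HasArc X vBot (vInt m)) ∨ ∃ m, HasArc X (vInt m) vTop) → False := by
    intro X hX hf he
    obtain ⟨a, ha⟩ := exists_leftF hX he
    exact not_lf_of_leftF (ha.transfer hf) hl
  rcases exists_inf_of_not_lf hT' hn with ⟨m, g, hg, h1, h2⟩ | ⟨m, g, hg, h1, h2⟩
  · obtain ⟨X, hX, -, hf, hgX⟩ := h g hg
    exact key X hX hf (Or.inl ⟨m, g, hgX, h1, h2⟩)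
  · obtain ⟨X, hX, -, hf, hgX⟩ := h g hg
    exact key X hX hf (Or.inr ⟨m, g, hgX, h1, h2⟩)

lemma side_cond {T : Set Arc} (hT : IsTriangulation T) {a b : Vtx} (ha : LeftF T a)
    (hb : RightF T b) :
    (a ≤ b ∨ (a = vTop ∧ ∃ n : ℤ, b = vInt n) ∨ ((∃ n : ℤ, a = vInt n) ∧ b = vBot)) := by
  rcases vcases a with rfl | rfl | ⟨n, rfl⟩ <;> rcases vcases b with rfl | rfl | ⟨n', rfl⟩ <;>
    simp [-vInt_le]
  · obtain ⟨p, hp, h1⟩ := ha.top 0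
    obtain ⟨q, hq, h2⟩ := hb.bot 1
    refine (nc hT h1 h2 ?_).elim
    simp [Cr]; omega
  · rw [vInt_le]
    by_contra hlt
    obtain ⟨p, hp, h1⟩ := ha.int (n' - 1)
    obtain ⟨q, hq, h2⟩ := hb.int (n + 1)
    refine nc hT h1 h2 ?_
    simp [Cr]; omega

lemma lower {T T' : Set Arc} (hT : IsTriangulation T) (hT' : IsTriangulation T') {a : Vtx}
    (ha : LeftF T a) (ha' : LeftF T' a) {y : Arc} (hy : y ∈ T') :
    ∃ N : ℤ, ∀ z ∈ T, Cross z y → ∀ u : ℤ, (z.src = vInt u ∨ z.tgt = vInt u) → N ≤ u := by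
  have hy' : HasArc T' y.src y.tgt := ⟨y, hy, rfl, rfl⟩
  have red : ∀ N : ℤ, (∀ c d, HasArc T c d → Cr c d y.src y.tgt →
      ∀ u : ℤ, (c = vInt u ∨ d = vInt u) → N ≤ u) →
      ∃ N : ℤ, ∀ z ∈ T, Cross z y → ∀ u : ℤ, (z.src = vInt u ∨ z.tgt = vInt u) → N ≤ u :=
    fun N h => ⟨N, fun z hz hc => h _ _ ⟨z, hz, rfl, rfl⟩ hc⟩
  generalize y.src = c at *
  generalize y.tgt = d at *
  -- a useful reduction: fix an arc of T, from the fountain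
  rcases vcases c with rfl | rfl | ⟨c, rfl⟩
  · rcases vcases d with rfl | rfl | ⟨d, rfl⟩
    · exact absurd hy'.lt (by simp)
    · exact red 0 (fun e f hef hcr => by simp [Cr] at hcr)
    · rcases vcases a with rfl | rfl | ⟨n, rfl⟩
      · obtain ⟨q, hq, h1⟩ := ha.bot d
        refine red q (fun e f hef hcr u hu => ?_)
        have h2 := nc hT h1 hef
        rcases vcases e with rfl | rfl | ⟨e, rfl⟩ <;> rcases vcases f with rfl | rfl | ⟨f, rfl⟩ <;>
          simp [Cr] at hcr h2 hu <;> omega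
      · obtain ⟨q, hq, h1⟩ := ha'.top (d - 1)
        refine (nc hT' h1 hy' ?_).elim
        simp [Cr]; omega
      · have hdn : n ≤ d := by
          by_contra hlt
          obtain ⟨q, hq, h1⟩ := ha'.int (d - 1)
          refine (nc hT' h1 hy' ?_).elim
          simp [Cr]; omega
        refine red n (fun e f hef hcr u hu => ?_)
        by_contra hlt
        obtain ⟨p, hp, h1⟩ := ha.int (u - 1)
        have h2 := nc hT h1 hef
        rcases vcases e with rfl | rfl | ⟨e, rfl⟩ <;> rcases vcases f with rfl | rfl | ⟨f, rfl⟩ <;>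
          simp [Cr] at hcr h2 hu <;> omega
  · exact absurd hy'.lt (by simp)
  · rcases vcases a with rfl | rfl | ⟨n, rfl⟩
    · obtain ⟨q, hq, h1⟩ := ha.bot c
      refine red q (fun e f hef hcr u hu => ?_)
      have h2 := nc hT h1 hef
      rcases vcases d with rfl | rfl | ⟨d, rfl⟩ <;>
        rcases vcases e with rfl | rfl | ⟨e, rfl⟩ <;> rcases vcases f with rfl | rfl | ⟨f, rfl⟩ <;>
          simp [Cr] at hcr h2 hu <;> omega
    · obtain ⟨q, hq, h1⟩ := ha.top c
      refine red q (fun e f hef hcr u hu => ?_)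
      have h2 := nc hT h1 hef
      rcases vcases d with rfl | rfl | ⟨d, rfl⟩ <;>
        rcases vcases e with rfl | rfl | ⟨e, rfl⟩ <;> rcases vcases f with rfl | rfl | ⟨f, rfl⟩ <;>
          simp [Cr] at hcr h2 hu <;> omega
    · by_cases hcn : c < n
      · have hd : d ≤ vInt n := by
          by_contra hlt
          obtain ⟨p, hp, h1⟩ := ha'.int (c - 1)
          refine nc hT' h1 hy' ?_
          rw [not_le] at hlt
          simp [Cr, hlt]; omega
        rw [← not_lt] at hd
        obtain ⟨p, hp, h1⟩ := ha.int c
        refine red p (fun e f hef hcr u hu => ?_)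
        have h2 := nc hT h1 hef
        rcases vcases d with rfl | rfl | ⟨d, rfl⟩ <;>
        rcases vcases e with rfl | rfl | ⟨e, rfl⟩ <;> rcases vcases f with rfl | rfl | ⟨f, rfl⟩ <;>
          simp [Cr] at hcr h2 hu hd <;> omega
      · refine red n (fun e f hef hcr u hu => ?_)
        by_contra hlt
        obtain ⟨p, hp, h1⟩ := ha.int (u - 1)
        have h2 := nc hT h1 hef
        rcases vcases d with rfl | rfl | ⟨d, rfl⟩ <;>
        rcases vcases e with rfl | rfl | ⟨e, rfl⟩ <;> rcases vcases f with rfl | rfl | ⟨f, rfl⟩ <;>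
          simp [Cr] at hcr h2 hu <;> omega

lemma upper {T T' : Set Arc} (hT : IsTriangulation T) (hT' : IsTriangulation T') {b : Vtx}
    (hb : RightF T b) (hb' : RightF T' b) {y : Arc} (hy : y ∈ T') :
    ∃ M : ℤ, ∀ z ∈ T, Cross z y → ∀ u : ℤ, (z.src = vInt u ∨ z.tgt = vInt u) → u ≤ M := by
  obtain ⟨N, hN⟩ := lower (revS_tri hT) (revS_tri hT') (leftF_rev.2 hb) (leftF_rev.2 hb')
    (y := y.rev) (by rw [mem_revS, rev_rev]; exact hy)
  refine ⟨-N, fun z hz hc u hu => ?_⟩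
  have := hN z.rev (by rw [mem_revS, rev_rev]; exact hz) ((cross_rev _ _).2 hc) (-u) (by
    rcases hu with hu | hu
    · right; simp [Arc.rev, hu]
    · left; simp [Arc.rev, hu])
  omega

lemma finite_cross_f {T T' : Set Arc} (hT : IsTriangulation T) (hT' : IsTriangulation T')
    {a b : Vtx} (ha : LeftF T a) (ha' : LeftF T' a) (hb : RightF T b) (hb' : RightF T' b) :
    ∀ y ∈ T', {x | x ∈ T ∧ Cross x y}.Finite := by
  intro y hy
  obtain ⟨N, hN⟩ := lower hT hT' ha ha' hy
  obtain ⟨M, hM⟩ := upper hT hT' hb hb' hy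
  have hV : (({vBot, vTop} : Set Vtx) ∪ vInt '' (Set.Icc N M)).Finite :=
    (Set.toFinite _).union ((Set.finite_Icc N M).image _)
  apply (arcs_in_finite _ hV).subset
  rintro x ⟨hx, hc⟩
  constructor
  · rcases vcases x.src with e | e | ⟨u, e⟩
    · rw [e]; simp
    · rw [e]; simp
    · right; rw [e]; exact ⟨u, ⟨hN x hx hc u (Or.inl e), hM x hx hc u (Or.inl e)⟩, rfl⟩
  · rcases vcases x.tgt with e | e | ⟨u, e⟩
    · rw [e]; simp
    · rw [e]; simp
    · right; rw [e]; exact ⟨u, ⟨hN x hx hc u (Or.inr e), hM x hx hc u (Or.inr e)⟩, rfl⟩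

lemma finite_cross_lf {T T' : Set Arc} (hT : IsTriangulation T) (hT' : IsTriangulation T')
    (hl : LocallyFin T) (hl' : LocallyFin T') :
    ∀ y ∈ T', {x | x ∈ T ∧ Cross x y}.Finite := by
  intro y hy
  have hno : ¬ ((∃ m, HasArc T' vBot (vInt m)) ∨ ∃ m, HasArc T' (vInt m) vTop) := by
    intro h
    obtain ⟨a, ha⟩ := exists_leftF hT' h
    exact not_lf_of_leftF ha hl'
  have hy' : HasArc T' y.src y.tgt := ⟨y, hy, rfl, rfl⟩
  rcases vcases y.src with e1 | e1 | ⟨c, e1⟩ <;> rcases vcases y.tgt with e2 | e2 | ⟨d, e2⟩ <;>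
    rw [e1, e2] at hy'
  · exact absurd hy'.lt (by simp)
  · convert Set.finite_empty
    ext x
    simp [Cross, e1, e2]
  · exact (hno (Or.inl ⟨d, hy'⟩)).elim
  · exact absurd hy'.lt (by simp)
  · exact absurd hy'.lt (by simp)
  · exact absurd hy'.lt (by simp)
  · exact absurd hy'.lt (by simp)
  · exact (hno (Or.inr ⟨c, hy'⟩)).elim
  · apply ((Set.finite_Icc c d).biUnion (fun u _ => hl (vInt u))).subset
    rintro x ⟨hx, hc⟩
    simp only [Set.mem_iUnion]
    simp only [Cross, e1, e2] at hc
    rcases hc with ⟨h1, h2, h3⟩ | ⟨h1, h2, h3⟩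
    · rcases vcases x.tgt with e | e | ⟨u, e⟩ <;> rw [e] at h2 h3 <;> simp at h2 h3
      exact ⟨u, ⟨by omega, by omega⟩, hx, Or.inr e⟩
    · rcases vcases x.src with e | e | ⟨u, e⟩ <;> rw [e] at h1 h2 <;> simp at h1 h2
      exact ⟨u, ⟨by omega, by omega⟩, hx, Or.inl e⟩

/-- Two triangulations of the completed ∞-gon are strongly mutation equivalent if and only
if they are both locally finite, or they both have a left fountain at `a` and a right
fountain at `b`, where `a ≤ b`, or `a = +∞` and `b ∈ ℤ`, or `a ∈ ℤ` and `b = −∞`. -/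
theorem statement15 (T T' : Set Arc) (hT : IsTriangulation T) (hT' : IsTriangulation T') :
    (leSc T T' ∧ leSc T' T) ↔
      ((LocallyFin T ∧ LocallyFin T') ∨
        ∃ a b : Vtx, LeftFountain T a ∧ RightFountain T b ∧
          LeftFountain T' a ∧ RightFountain T' b ∧
          (a ≤ b ∨ (a = vTop ∧ ∃ n : ℤ, b = vInt n) ∨ ((∃ n : ℤ, a = vInt n) ∧ b = vBot))) := by
  constructor
  · rintro ⟨h1, h2⟩
    have n1 := nearBy_of_leSc hT h1
    have n2 := nearBy_of_leSc hT' h2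
    by_cases hl : LocallyFin T
    · exact Or.inl ⟨hl, lf_of_nearBy hT' n1 hl⟩
    · have hl' : ¬ LocallyFin T' := fun h => hl (lf_of_nearBy hT n2 h)
      have i1 := exists_inf_of_not_lf hT hl
      have i2 := exists_inf_of_not_lf hT' hl'
      obtain ⟨a, ha⟩ := exists_leftF hT i1
      obtain ⟨b, hb⟩ := exists_rightF hT i1
      obtain ⟨a', ha'⟩ := exists_leftF hT' i2
      obtain ⟨b', hb'⟩ := exists_rightF hT' i2
      obtain rfl := leftF_unique hT hT' n1 n2 ha ha'
      obtain rfl := rightF_unique hT hT' n1 n2 hb hb'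
      exact Or.inr ⟨a, b, leftF_iff.2 ha, rightF_iff.2 hb, leftF_iff.2 ha', rightF_iff.2 hb',
        side_cond hT ha hb⟩
  · rintro (⟨hl, hl'⟩ | ⟨a, b, ha, hb, ha', hb', -⟩)
    · have f1 := finite_cross_lf hT hT' hl hl'
      have f2 := finite_cross_lf hT' hT hl' hl
      exact ⟨leSc_of_finite_cross hT hT' f1 f2, leSc_of_finite_cross hT' hT f2 f1⟩
    · rw [leftF_iff] at ha ha'
      rw [rightF_iff] at hb hb'
      have f1 := finite_cross_f hT hT' ha ha' hb hb'
      have f2 := finite_cross_f hT' hT ha' ha hb' hb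
      exact ⟨leSc_of_finite_cross hT hT' f1 f2, leSc_of_finite_cross hT' hT f2 f1⟩
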